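/- Let G and H be rayless graphs, let X ⊆ V(G) and Y ⊆ V(H) be finite vertex sets, suppose the pairs (G,X) and (H,Y) are weak twins, and suppose both G − X and H − Y are connected. Then there exist infinitely many pairwise non-isomorphic pairs (H',Y') with H' − Y' connected, each of which is a weak twin of (G,X). -/

import Mathlib

/-- A graph is rayless if it contains no ray, i.e. no infinite sequence of distinct
vertices `v₀, v₁, v₂, …` with `vᵢ` adjacent to `vᵢ₊₁` for all `i`. -/
def SimpleGraph.IsRayless {V : Type*} (G : SimpleGraph V) : Prop :=
  ¬ ∃ f : ℕ → V, Function.Injective f ∧ ∀ n, G.Adj (f n) (f (n + 1))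

/-- Two pairs `(G, X)` and `(H, Y)` are isomorphic if there is a graph isomorphism
`γ : G ≃g H` with `γ(X) = Y`. -/
def PairIso {V W : Type*} (G : SimpleGraph V) (X : Set V)
    (H : SimpleGraph W) (Y : Set W) : Prop :=
  ∃ γ : G ≃g H, ⇑γ '' X = Y

/-- Two pairs `(G, X)` and `(H, Y)` are weak twins if they are not isomorphic as
pairs, yet there are injective graph homomorphisms `φ : G →g H` with `φ(X) = Y` and
`ψ : H →g G` with `ψ(Y) = X`. -/
def WeakTwinPairs {V W : Type*} (G : SimpleGraph V) (X : Set V)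
    (H : SimpleGraph W) (Y : Set W) : Prop :=
  ¬ PairIso G X H Y ∧ (∃ φ : G →g H, Function.Injective φ ∧ ⇑φ '' X = Y) ∧
    (∃ ψ : H →g G, Function.Injective ψ ∧ ⇑ψ '' Y = X)

universe u

namespace Tw
open Relation

lemma rtg_lift {α β : Type*} {r : α → α → Prop} {s : β → β → Prop} (f : α → β)
    (h : ∀ a b, r a b → s (f a) (f b)) {a b : α} (hab : ReflTransGen r a b) :
    ReflTransGen s (f a) (f b) := by
  induction hab with
  | refl => exact .refl
  | tail _ h1 ih => exact ih.tail (h _ _ h1)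

lemma rtg_mono {α : Type*} {r s : α → α → Prop}
    (h : ∀ a b, r a b → s a b) {a b : α} (hab : ReflTransGen r a b) :
    ReflTransGen s a b := rtg_lift (fun x => x) h hab

section graph
variable {V W : Type u}

/-- One step along an edge inside the vertex set `D`. -/
def RIn (G : SimpleGraph V) (D : Set V) (a b : V) : Prop := G.Adj a b ∧ a ∈ D ∧ b ∈ D

/-- `D` is a nonempty connected vertex set. -/
def COn (G : SimpleGraph V) (D : Set V) : Prop :=
  D.Nonempty ∧ ∀ x ∈ D, ∀ y ∈ D, ReflTransGen (RIn G D) x y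

/-- The component of `x` in `G[D]`. -/
def comp (G : SimpleGraph V) (D : Set V) (x : V) : Set V := {y | ReflTransGen (RIn G D) x y}

lemma RIn_symm (G : SimpleGraph V) (D : Set V) : Std.Symm (RIn G D) :=
  ⟨fun _ _ h => ⟨h.1.symm, h.2.2, h.2.1⟩⟩

lemma reach_symm {G : SimpleGraph V} {D : Set V} {x y : V}
    (h : ReflTransGen (RIn G D) x y) : ReflTransGen (RIn G D) y x := by
  induction h with
  | refl => exact .refl
  | tail _ h ih => exact ReflTransGen.head ⟨h.1.symm, h.2.2, h.2.1⟩ ih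

lemma reach_mono {G : SimpleGraph V} {D D' : Set V} (hD : D ⊆ D') {x y : V}
    (h : ReflTransGen (RIn G D) x y) : ReflTransGen (RIn G D') x y :=
  rtg_mono (fun _ _ h => ⟨h.1, hD h.2.1, hD h.2.2⟩) h

lemma comp_subset {G : SimpleGraph V} {D : Set V} {x : V} (hx : x ∈ D) : comp G D x ⊆ D := by
  intro y hy
  change ReflTransGen (RIn G D) x y at hy
  cases hy with
  | refl => exact hx
  | tail _ h => exact h.2.2

lemma comp_self {G : SimpleGraph V} {D : Set V} {x : V} : x ∈ comp G D x := ReflTransGen.refl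

lemma comp_conn (G : SimpleGraph V) (D : Set V) (x : V) : COn G (comp G D x) := by
  have key : ∀ y, ReflTransGen (RIn G D) x y → ReflTransGen (RIn G (comp G D x)) x y := by
    intro y h
    induction h with
    | refl => exact .refl
    | tail h1 h ih => exact ih.tail ⟨h.1, h1, h1.tail h⟩
  exact ⟨⟨x, comp_self⟩, fun y hy z hz => (reach_symm (key y hy)).trans (key z hz)⟩

lemma subset_comp {G : SimpleGraph V} {C D : Set V} {x d : V} (hC : COn G C) (hCD : C ⊆ D)
    (hd : d ∈ C) (hdx : ReflTransGen (RIn G D) x d) : C ⊆ comp G D x := by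
  intro y hy
  exact hdx.trans (reach_mono hCD (hC.2 d hd y hy))

lemma first_hit {α : Type*} {r : α → α → Prop} (Z : Set α) {a b : α} (h : ReflTransGen r a b)
    (ha : a ∉ Z) (hb : b ∈ Z) : ∃ y z, y ∉ Z ∧ z ∈ Z ∧
      ReflTransGen (fun p q => r p q ∧ p ∉ Z ∧ q ∉ Z) a y ∧ r y z := by
  induction h using ReflTransGen.head_induction_on with
  | refl => exact absurd hb ha
  | @head a c hac hcb ih =>
    by_cases hc : c ∈ Z
    · exact ⟨a, c, ha, hc, .refl, hac⟩
    · obtain ⟨y, z, hy, hz, h1, h2⟩ := ih hc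
      exact ⟨y, z, hy, hz, ReflTransGen.head ⟨hac, ha, hc⟩ h1, h2⟩

/-- The ray construction. -/
lemma not_rayless {G : SimpleGraph V} (B : Set (Set V)) (hB : ∀ C ∈ B, COn G C)
    (hstep : ∀ C ∈ B, ∀ v ∈ C, ∃ C' ∈ B, C' ⊆ C ∧ v ∉ C') (hne : B.Nonempty) :
    ¬ G.IsRayless := by
  intro hray
  apply hray
  let S := {s : Set V × V // COn G s.1 ∧ s.2 ∈ s.1 ∧ ∃ C ∈ B, C ⊆ s.1}
  have step : ∀ s : S, ∃ t : S, G.Adj s.1.2 t.1.2 ∧ t.1.1 ⊆ s.1.1 \ {s.1.2} := by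
    rintro ⟨⟨D, v⟩, hD, hv, C, hCB, hCD⟩
    obtain ⟨C', hC'B, hC'D, hvC'⟩ : ∃ C' ∈ B, C' ⊆ D ∧ v ∉ C' := by
      by_cases hvC : v ∈ C
      · obtain ⟨C', h1, h2, h3⟩ := hstep C hCB v hvC
        exact ⟨C', h1, h2.trans hCD, h3⟩
      · exact ⟨C, hCB, hCD, hvC⟩
    obtain ⟨c, hc⟩ := (hB C' hC'B).1
    have hcD : c ∈ D \ {v} := ⟨hC'D hc, fun h => hvC' (by rw [← Set.mem_singleton_iff.1 h]; exact hc)⟩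
    obtain ⟨y, z, hy, hz, h1, h2⟩ := first_hit {v} (hD.2 c hcD.1 v hv) hcD.2 rfl
    have hz' : z = v := hz
    subst hz'
    have hyc : y ∈ comp G (D \ {z}) c :=
      rtg_mono (fun p q h => ⟨h.1.1, ⟨h.1.2.1, h.2.1⟩, ⟨h.1.2.2, h.2.2⟩⟩) h1
    refine ⟨⟨(comp G (D \ {z}) c, y), comp_conn _ _ _, hyc, C', hC'B, ?_⟩, h2.1.symm, ?_⟩
    · refine subset_comp (hB C' hC'B) ?_ hc .refl
      intro w hw
      exact ⟨hC'D hw, fun h => hvC' (by rw [← Set.mem_singleton_iff.1 h]; exact hw)⟩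
    · exact comp_subset hcD
  choose nx hnx1 hnx2 using step
  obtain ⟨C, hC⟩ := hne
  obtain ⟨v, hv⟩ := (hB C hC).1
  let s0 : S := ⟨(C, v), hB C hC, hv, C, hC, subset_rfl⟩
  let s : ℕ → S := fun n => nx^[n] s0
  have hs : ∀ n, s (n+1) = nx (s n) := fun n => Function.iterate_succ_apply' nx n s0
  have hsub : ∀ n k, (s (n + k)).1.1 ⊆ (s n).1.1 := by
    intro n k
    induction k with
    | zero => exact subset_rfl
    | succ k ih =>
      rw [← add_assoc, hs]
      exact (hnx2 _).trans (Set.sdiff_subset.trans ih)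
  have hlt : ∀ n m, n < m → (s n).1.2 ≠ (s m).1.2 := by
    intro n m hnm heq
    obtain ⟨k, rfl⟩ := Nat.exists_eq_add_of_lt hnm
    have h1 : (s (n+k+1)).1.2 ∈ (s (n+1)).1.1 := by
      have := hsub (n+1) k
      rw [show n + 1 + k = n + k + 1 by omega] at this
      exact this (s (n+k+1)).2.2.1
    rw [hs n] at h1
    exact (hnx2 _ h1).2 heq.symm
  refine ⟨fun n => (s n).1.2, ?_, ?_⟩
  · intro n m h
    rcases lt_trichotomy n m with h1 | h1 | h1
    · exact absurd h (hlt _ _ h1)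
    · exact h1
    · exact absurd h.symm (hlt _ _ h1)
  · intro n
    show G.Adj (s n).1.2 (s (n+1)).1.2
    rw [hs]; exact hnx1 _

/-- Schmidt's rank: `Rk G α S` says that `G[S]` has rank at most `α`. -/
def Rk (G : SimpleGraph V) (α : Ordinal.{u}) (S : Set V) : Prop :=
  ∃ K : Set V, K.Finite ∧ ∀ C ⊆ S \ K, COn G C → ∃ β, ∃ _ : β < α, Rk G β C
termination_by α

lemma Rk_iff (G : SimpleGraph V) (α : Ordinal.{u}) (S : Set V) : Rk G α S ↔
    ∃ K : Set V, K.Finite ∧ ∀ C ⊆ S \ K, COn G C → ∃ β < α, Rk G β C := by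
  rw [Rk]; simp only [exists_prop]

lemma COn_image {G : SimpleGraph V} {H : SimpleGraph W} {f : V → W}
    (hf : ∀ x y, G.Adj x y → H.Adj (f x) (f y)) {C : Set V} (hC : COn G C) : COn H (f '' C) := by
  refine ⟨hC.1.image f, ?_⟩
  rintro _ ⟨x, hx, rfl⟩ _ ⟨y, hy, rfl⟩
  refine rtg_lift f ?_ (hC.2 x hx y hy)
  intro a b h
  exact ⟨hf _ _ h.1, ⟨a, h.2.1, rfl⟩, ⟨b, h.2.2, rfl⟩⟩

lemma Rk_pull {G : SimpleGraph V} {H : SimpleGraph W} {f : V → W} (hi : Function.Injective f)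
    (hf : ∀ x y, G.Adj x y → H.Adj (f x) (f y)) (α : Ordinal.{u}) :
    ∀ (S : Set V) (T : Set W), f '' S ⊆ T → Rk H α T → Rk G α S := by
  induction α using WellFoundedLT.induction with
  | ind α ih =>
  intro S T hST hT
  rw [Rk_iff] at hT ⊢
  obtain ⟨K, hK, h⟩ := hT
  refine ⟨f ⁻¹' K, hK.preimage hi.injOn, fun C hC hCc => ?_⟩
  obtain ⟨β, hβ, hR⟩ := h (f '' C) (by
    rintro _ ⟨x, hx, rfl⟩
    exact ⟨hST ⟨x, (hC hx).1, rfl⟩, (hC hx).2⟩) (COn_image hf hCc)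
  exact ⟨β, hβ, ih β hβ C _ subset_rfl hR⟩

lemma Rk_subset {G : SimpleGraph V} {α : Ordinal.{u}} {S T : Set V} (h : S ⊆ T) (hT : Rk G α T) :
    Rk G α S :=
  Rk_pull (f := id) Function.injective_id (fun _ _ h => h) α S T (by simpa using h) hT

lemma Rk_mono {G : SimpleGraph V} {α β : Ordinal.{u}} {S : Set V} (h : α ≤ β) (hT : Rk G α S) :
    Rk G β S := by
  rw [Rk_iff] at hT ⊢
  obtain ⟨K, hK, hh⟩ := hT
  refine ⟨K, hK, fun C hC hCc => ?_⟩
  obtain ⟨γ, hγ, hR⟩ := hh C hC hCc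
  exact ⟨γ, hγ.trans_le h, hR⟩

lemma exists_Rk {G : SimpleGraph V} (hG : G.IsRayless) : ∃ α, Rk G α Set.univ := by
  by_contra hbad
  have key : ∀ S : Set V, (∀ α, ¬ Rk G α S) → ∀ K : Set V, K.Finite →
      ∃ C ⊆ S \ K, COn G C ∧ ∀ α, ¬ Rk G α C := by
    intro S hS K hK
    by_contra hcon
    push Not at hcon
    have : ∀ C : Set V, ∃ α, C ⊆ S \ K → COn G C → Rk G α C := by
      intro C
      by_cases h : C ⊆ S \ K ∧ COn G C
      · obtain ⟨α, hα⟩ := hcon C h.1 h.2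
        exact ⟨α, fun _ _ => hα⟩
      · exact ⟨0, fun h1 h2 => absurd ⟨h1, h2⟩ h⟩
    choose b hb using this
    apply hS (⨆ C : Set V, Order.succ (b C))
    rw [Rk_iff]
    refine ⟨K, hK, fun C hC hCc => ⟨b C, ?_, hb C hC hCc⟩⟩
    exact (Order.lt_succ (b C)).trans_le (Ordinal.le_iSup (fun C => Order.succ (b C)) C)
  push Not at hbad
  refine not_rayless {C : Set V | COn G C ∧ ∀ α, ¬ Rk G α C} (fun C h => h.1) ?_ ?_ hG
  · rintro C ⟨_, hC⟩ v hv
    obtain ⟨C', h1, h2, h3⟩ := key C hC {v} (Set.finite_singleton v)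
    exact ⟨C', ⟨h2, h3⟩, h1.trans Set.sdiff_subset, fun h => (h1 h).2 rfl⟩
  · obtain ⟨C', h1, h2, h3⟩ := key _ hbad ∅ Set.finite_empty
    exact ⟨C', h2, h3⟩

/-- `K` is a finite set whose removal leaves only parts of rank less than `α`. -/
def Sep (G : SimpleGraph V) (α : Ordinal.{u}) (K : Set V) : Prop :=
  K.Finite ∧ ∀ C ⊆ Kᶜ, COn G C → ∃ β < α, Rk G β C

lemma Sep_inter {G : SimpleGraph V} {α : Ordinal.{u}} {K K' : Set V} (hK : Sep G α K)
    (hK' : Sep G α K') : Sep G α (K ∩ K') := by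
  refine ⟨hK.1.subset Set.inter_subset_left, fun C hC hCc => ?_⟩
  by_cases hne : (C ∩ (K ∪ K')).Nonempty
  swap
  · refine hK.2 C (fun x hx hxK => hne ⟨x, hx, Or.inl hxK⟩) hCc
  -- the pieces
  have hfin : (C ∩ (K ∪ K')).Finite := (hK.1.union hK'.1).subset Set.inter_subset_right
  have piece : ∀ z : V, ∃ β, ∃ Q : Set V, Q.Finite ∧ (z ∈ C ∩ (K ∪ K') → β < α ∧
      ∀ D ⊆ C \ (K ∪ K' ∪ Q), COn G D → (D ⊆ comp G (C \ K') z ∧ z ∈ K ∨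
        D ⊆ comp G (C \ K) z ∧ z ∈ K') → ∃ γ < β, Rk G γ D) := by
    intro z
    by_cases hz : z ∈ C ∩ (K ∪ K')
    swap
    · exact ⟨0, ∅, Set.finite_empty, fun h => absurd h hz⟩
    have : ∃ P : Set V, (∃ β < α, Rk G β P) ∧ (z ∈ K → comp G (C \ K') z ⊆ P) ∧
        (z ∈ K' → comp G (C \ K) z ⊆ P) := by
      rcases hz.2 with hzK | hzK
      · have hz' : z ∉ K' := fun h => hC hz.1 ⟨hzK, h⟩
        refine ⟨comp G (C \ K') z, hK'.2 _ ?_ (comp_conn _ _ _), fun _ => subset_rfl,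
          fun h => absurd h hz'⟩
        exact fun x hx => (comp_subset (D := _ \ _) ⟨hz.1, hz'⟩ hx).2
      · have hz' : z ∉ K := fun h => hC hz.1 ⟨h, hzK⟩
        refine ⟨comp G (C \ K) z, hK.2 _ ?_ (comp_conn _ _ _), fun h => absurd h hz',
          fun _ => subset_rfl⟩
        exact fun x hx => (comp_subset (D := _ \ _) ⟨hz.1, hz'⟩ hx).2
    obtain ⟨P, ⟨β, hβ, hP⟩, h1, h2⟩ := this
    rw [Rk_iff] at hP
    obtain ⟨Q, hQ, hh⟩ := hP
    refine ⟨β, Q, hQ, fun _ => ⟨hβ, fun D hD hDc hor => hh D ?_ hDc⟩⟩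
    intro x hx
    refine ⟨?_, fun h => (hD hx).2 (Or.inr h)⟩
    rcases hor with h | h
    · exact h1 h.2 (h.1 hx)
    · exact h2 h.2 (h.1 hx)
  choose b Q hQ hb using piece
  obtain ⟨z0, hz0, hmax⟩ := Set.exists_max_image _ b hfin hne
  refine ⟨b z0, (hb z0 hz0).1, ?_⟩
  rw [Rk_iff]
  refine ⟨K ∪ K' ∪ ⋃ z ∈ C ∩ (K ∪ K'), Q z, (hK.1.union hK'.1).union
    (hfin.biUnion fun z _ => hQ z), fun D hD hDc => ?_⟩
  obtain ⟨d, hd⟩ := hDc.1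
  obtain ⟨x0, hx0⟩ := hne
  have hdZ : d ∉ K ∪ K' := fun h => (hD hd).2 (Or.inl h)
  obtain ⟨y, z, hy, hz, h1, h2⟩ := first_hit (K ∪ K') (hCc.2 d (hD hd).1 x0 hx0.1) hdZ hx0.2
  have hzC : z ∈ C ∩ (K ∪ K') := ⟨h2.2.2, hz⟩
  have hor : D ⊆ comp G (C \ K') z ∧ z ∈ K ∨ D ⊆ comp G (C \ K) z ∧ z ∈ K' := by
    have aux : ∀ M : Set V, M ⊆ K ∪ K' → z ∉ M → D ⊆ comp G (C \ M) z := by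
      intro M hM hzM
      refine subset_comp (d := d) hDc ?_ hd (reach_symm ?_)
      · intro x hx
        exact ⟨(hD hx).1, fun h => (hD hx).2 (Or.inl (hM h))⟩
      · refine ReflTransGen.tail (b := y) ?_ ⟨h2.1, ⟨h2.2.1, fun h => hy (hM h)⟩, ⟨h2.2.2, hzM⟩⟩
        exact rtg_mono (fun p q h =>
          ⟨h.1.1, ⟨h.1.2.1, fun h' => h.2.1 (hM h')⟩, ⟨h.1.2.2, fun h' => h.2.2 (hM h')⟩⟩) h1
    rcases hz with hzK | hzK
    · exact Or.inl ⟨aux K' Set.subset_union_right (fun h => hC hzC.1 ⟨hzK, h⟩), hzK⟩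
    · exact Or.inr ⟨aux K Set.subset_union_left (fun h => hC hzC.1 ⟨h, hzK⟩), hzK⟩
  obtain ⟨γ, hγ, hR⟩ := (hb z hzC).2 D (by
    intro x hx
    refine ⟨(hD hx).1, fun h => (hD hx).2 ?_⟩
    rcases h with h | h
    · exact Or.inl h
    · exact Or.inr (Set.mem_biUnion hzC h)) hDc hor
  exact ⟨γ, hγ.trans_le (hmax z hzC), hR⟩

/-- The kernel. -/
def Ker (G : SimpleGraph V) (α : Ordinal.{u}) : Set V := {x | ∀ K, Sep G α K → x ∈ K}

lemma Sep_Ker {G : SimpleGraph V} {α : Ordinal.{u}} (h : Rk G α Set.univ) :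
    Sep G α (Ker G α) := by
  rw [Rk_iff] at h
  obtain ⟨K0, hK0, h0⟩ := h
  have hS0 : Sep G α K0 := ⟨hK0, fun C hC => h0 C (fun x hx => ⟨trivial, hC hx⟩)⟩
  -- a separator of minimal size
  have hex : ∃ n, ∃ K, Sep G α K ∧ K.ncard = n := ⟨_, K0, hS0, rfl⟩
  classical
  obtain ⟨K, hK, hn⟩ := Nat.find_spec hex
  have hKer : Ker G α = K := by
    refine Set.Subset.antisymm (fun x (hx : ∀ K, Sep G α K → x ∈ K) => hx K hK) ?_
    intro x hx K' hK'
    have h1 := Sep_inter hK hK'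
    have h2 : K ∩ K' = K := by
      apply Set.eq_of_subset_of_ncard_le Set.inter_subset_left _ hK.1
      rw [hn]
      exact Nat.find_min' hex ⟨_, h1, rfl⟩
    rw [← h2] at hx
    exact hx.2
  rw [hKer]; exact hK

lemma Ker_map {G : SimpleGraph V} {H : SimpleGraph W} {f : V → W} (hi : Function.Injective f)
    (hf : ∀ x y, G.Adj x y → H.Adj (f x) (f y)) (α : Ordinal.{u}) :
    f '' Ker G α ⊆ Ker H α := by
  rintro _ ⟨x, hx, rfl⟩ K hK
  refine hx (f ⁻¹' K) ⟨hK.1.preimage hi.injOn, fun C hC hCc => ?_⟩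
  obtain ⟨β, hβ, hR⟩ := hK.2 (f '' C) (by rintro _ ⟨y, hy, rfl⟩; exact hC hy) (COn_image hf hCc)
  exact ⟨β, hβ, Rk_pull hi hf β _ _ subset_rfl hR⟩

lemma Ker_eq {G : SimpleGraph V} {H : SimpleGraph W} {f : V → W} (hi : Function.Injective f)
    (hf : ∀ x y, G.Adj x y → H.Adj (f x) (f y)) {g : W → V} (hig : Function.Injective g)
    (hg : ∀ x y, H.Adj x y → G.Adj (g x) (g y)) (α : Ordinal.{u}) (h : Rk G α Set.univ) :
    f '' Ker G α = Ker H α := by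
  have hH : Rk H α Set.univ := Rk_pull hig hg α _ _ (Set.subset_univ _) h
  have f1 := (Sep_Ker h).1
  have f2 := (Sep_Ker hH).1
  apply Set.eq_of_subset_of_ncard_le (Ker_map hi hf α) _ f2
  rw [Set.ncard_image_of_injective _ hi, ← Set.ncard_image_of_injective _ hig]
  exact Set.ncard_le_ncard (Ker_map hig hg α) f1

end graph
end Tw

namespace Tw
open Relation

/-- Graphs whose vertices carry sets of labels from `L`. -/
structure CG (L : Type u) where
  V : Type u
  g : SimpleGraph V
  c : V → Set L

section cg
variable {L : Type u}

structure IsEmb (A B : CG L) (f : A.V → B.V) : Prop where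
  inj : Function.Injective f
  adj : ∀ x y, A.g.Adj x y → B.g.Adj (f x) (f y)
  col : ∀ x, A.c x ⊆ B.c (f x)

def Le (A B : CG L) : Prop := ∃ f, IsEmb A B f
def Eqv (A B : CG L) : Prop := Le A B ∧ Le B A
def IsIso (A B : CG L) (e : A.V ≃ B.V) : Prop := IsEmb A B e ∧ IsEmb B A e.symm
def Iso (A B : CG L) : Prop := ∃ e, IsIso A B e
def Conn (A : CG L) : Prop := Nonempty A.V ∧ ∀ x y, ReflTransGen A.g.Adj x y

lemma IsEmb.id (A : CG L) : IsEmb A A (fun x => x) :=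
  ⟨fun _ _ h => h, fun _ _ h => h, fun _ => subset_rfl⟩

lemma IsEmb.comp {A B C : CG L} {f : A.V → B.V} {g : B.V → C.V} (hg : IsEmb B C g)
    (hf : IsEmb A B f) : IsEmb A C (fun x => g (f x)) :=
  ⟨fun _ _ h => hf.inj (hg.inj h), fun _ _ h => hg.adj _ _ (hf.adj _ _ h),
    fun x => (hf.col x).trans (hg.col _)⟩

lemma Le.refl (A : CG L) : Le A A := ⟨_, IsEmb.id A⟩
lemma Le.trans {A B C : CG L} (h : Le A B) (h' : Le B C) : Le A C := by
  obtain ⟨f, hf⟩ := h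
  obtain ⟨g, hg⟩ := h'
  exact ⟨_, hg.comp hf⟩
lemma Eqv.refl (A : CG L) : Eqv A A := ⟨Le.refl A, Le.refl A⟩
lemma Eqv.symm {A B : CG L} (h : Eqv A B) : Eqv B A := ⟨h.2, h.1⟩
lemma Eqv.trans {A B C : CG L} (h : Eqv A B) (h' : Eqv B C) : Eqv A C :=
  ⟨h.1.trans h'.1, h'.2.trans h.2⟩
lemma IsIso.symm {A B : CG L} {e : A.V ≃ B.V} (h : IsIso A B e) : IsIso B A e.symm :=
  ⟨h.2, h.1⟩
lemma IsIso.trans {A B C : CG L} {e : A.V ≃ B.V} {e' : B.V ≃ C.V} (h : IsIso A B e)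
    (h' : IsIso B C e') : IsIso A C (e.trans e') :=
  ⟨h'.1.comp h.1, h.2.comp h'.2⟩
lemma Iso.eqv {A B : CG L} (h : Iso A B) : Eqv A B := by
  obtain ⟨e, h⟩ := h
  exact ⟨⟨_, h.1⟩, ⟨_, h.2⟩⟩
lemma Iso.refl (A : CG L) : Iso A A := ⟨Equiv.refl _, IsEmb.id A, IsEmb.id A⟩
lemma Iso.symm {A B : CG L} (h : Iso A B) : Iso B A := by
  obtain ⟨e, h⟩ := h
  exact ⟨_, h.symm⟩
lemma Iso.trans {A B C : CG L} (h : Iso A B) (h' : Iso B C) : Iso A C := by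
  obtain ⟨e, h⟩ := h
  obtain ⟨e', h'⟩ := h'
  exact ⟨_, h.trans h'⟩

lemma iso_of_bij {A B : CG L} (f : A.V → B.V) (hf : Function.Bijective f)
    (hadj : ∀ x y, A.g.Adj x y ↔ B.g.Adj (f x) (f y)) (hc : ∀ x, A.c x = B.c (f x)) :
    IsIso A B (Equiv.ofBijective f hf) := by
  refine ⟨⟨hf.1, fun x y => (hadj x y).1, fun x => (hc x).le⟩, ?_⟩
  have hs : ∀ y, f ((Equiv.ofBijective f hf).symm y) = y :=
    (Equiv.ofBijective f hf).apply_symm_apply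
  refine ⟨(Equiv.ofBijective f hf).symm.injective, fun x y h => ?_, fun x => ?_⟩
  · rw [hadj, hs, hs]; exact h
  · rw [hc, hs]

lemma IsIso.adj {A B : CG L} {e : A.V ≃ B.V} (h : IsIso A B e) (x y : A.V) :
    A.g.Adj x y ↔ B.g.Adj (e x) (e y) :=
  ⟨h.1.adj x y, fun h' => by simpa using h.2.adj _ _ h'⟩

lemma IsIso.col {A B : CG L} {e : A.V ≃ B.V} (h : IsIso A B e) (x : A.V) :
    A.c x = B.c (e x) :=
  (h.1.col x).antisymm (by simpa using h.2.col (e x))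

lemma rayless_of_le {A B : CG L} (h : Le A B) (hB : B.g.IsRayless) : A.g.IsRayless := by
  rintro ⟨s, hs, ha⟩
  obtain ⟨f, hf⟩ := h
  exact hB ⟨fun n => f (s n), fun _ _ h => hs (hf.inj h), fun n => hf.adj _ _ (ha n)⟩

lemma conn_of_iso {A B : CG L} (h : Iso A B) (hA : Conn A) : Conn B := by
  obtain ⟨e, he⟩ := h
  obtain ⟨⟨a⟩, h⟩ := hA
  refine ⟨⟨e a⟩, fun x y => ?_⟩
  have := rtg_lift e he.1.adj (h (e.symm x) (e.symm y))
  simpa using this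

lemma COn_range {A B : CG L} (hA : Conn A) {f : A.V → B.V} (hf : IsEmb A B f) :
    COn B.g (Set.range f) := by
  rw [← Set.image_univ]
  refine COn_image hf.adj ⟨?_, fun x _ y _ => ?_⟩
  · obtain ⟨⟨a⟩, -⟩ := hA
    exact ⟨a, trivial⟩
  · exact rtg_mono (fun a b h => ⟨h, trivial, trivial⟩) (hA.2 x y)

/-- A connected rayless graph does not contain two disjoint copies of itself. -/
lemma no_double {p : CG L} (hp : Conn p) (hr : p.g.IsRayless) {f g : p.V → p.V}
    (hf : IsEmb p p f) (hg : IsEmb p p g) (hd : ∀ x y, f x ≠ g y) : False := by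
  refine not_rayless {R | ∃ h, IsEmb p p h ∧ R = Set.range h} ?_ ?_ ?_ hr
  · rintro _ ⟨h, hh, rfl⟩
    exact COn_range hp hh
  · rintro _ ⟨h, hh, rfl⟩ _ ⟨x, rfl⟩
    by_cases hx : x ∈ Set.range f
    · refine ⟨_, ⟨_, hh.comp hg, rfl⟩, ?_, ?_⟩
      · rintro _ ⟨y, rfl⟩; exact ⟨_, rfl⟩
      · rintro ⟨y, hy⟩
        obtain ⟨z, rfl⟩ := hx
        exact hd _ _ (hh.inj hy).symm
    · refine ⟨_, ⟨_, hh.comp hf, rfl⟩, ?_, ?_⟩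
      · rintro _ ⟨y, rfl⟩; exact ⟨_, rfl⟩
      · rintro ⟨y, hy⟩
        exact hx ⟨y, hh.inj hy⟩
  · exact ⟨_, _, IsEmb.id p, rfl⟩

inductive SgAdj {I : Type u} (C : I → CG L) : (Σ i, (C i).V) → (Σ i, (C i).V) → Prop
  | mk (i : I) (v w : (C i).V) : (C i).g.Adj v w → SgAdj C ⟨i, v⟩ ⟨i, w⟩

/-- Disjoint union. -/
abbrev Sg (I : Type u) (C : I → CG L) : CG L where
  V := Σ i, (C i).V
  g := { Adj := SgAdj C
         symm := ⟨by rintro _ _ ⟨i, v, w, h⟩; exact ⟨i, w, v, h.symm⟩⟩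
         loopless := ⟨by
          intro x h
          generalize hy : x = y at h
          have h' : SgAdj C x y := by rw [← hy] at h ⊢; exact h
          clear h
          cases h' with
          | mk i v w h =>
            have := eq_of_heq (Sigma.mk.inj hy).2
            subst this
            exact h.ne rfl⟩ }
  c := fun x => (C x.1).c x.2

variable {I J : Type u} {C : I → CG L} {D : J → CG L}

lemma Sg_adj (i : I) (v w : (C i).V) :
    (Sg I C).g.Adj ⟨i, v⟩ ⟨i, w⟩ ↔ (C i).g.Adj v w := by
  constructor
  · intro h
    change SgAdj C _ _ at h
    cases h with
    | mk _ _ _ h => exact h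
  · exact fun h => SgAdj.mk i v w h

lemma Sg_idx {x y : (Sg I C).V} (h : (Sg I C).g.Adj x y) : x.1 = y.1 := by
  change SgAdj C x y at h
  cases h; rfl

lemma Sg_reach_idx {x y : (Sg I C).V} (h : ReflTransGen (Sg I C).g.Adj x y) : x.1 = y.1 := by
  induction h with
  | refl => rfl
  | tail _ h ih => exact ih.trans (Sg_idx h)

lemma IsEmb_incl (i : I) : IsEmb (C i) (Sg I C) (fun v => ⟨i, v⟩) :=
  ⟨fun _ _ h => eq_of_heq (Sigma.mk.inj h).2, fun _ _ h => (Sg_adj i _ _).2 h, fun _ => subset_rfl⟩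

lemma Sg_split (hC : ∀ i, Conn (C i)) {f : (Sg I C).V → (Sg J D).V}
    (hf : IsEmb (Sg I C) (Sg J D) f) :
    ∃ (fh : I → J) (fc : ∀ i, (C i).V → (D (fh i)).V),
      (∀ i v, f ⟨i, v⟩ = ⟨fh i, fc i v⟩) ∧ ∀ i, IsEmb (C i) (D (fh i)) (fc i) := by
  have h1 : ∀ i, ∃ j, ∀ v : (C i).V, ∃ w : (D j).V, f ⟨i, v⟩ = ⟨j, w⟩ := by
    intro i
    obtain ⟨⟨v0⟩, hr⟩ := hC i
    refine ⟨(f ⟨i, v0⟩).1, fun v => ?_⟩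
    have : (f ⟨i, v0⟩).1 = (f ⟨i, v⟩).1 :=
      Sg_reach_idx (rtg_lift (fun v => f ⟨i, v⟩) (hf.comp (IsEmb_incl i)).adj (hr v0 v))
    rw [this]
    exact ⟨_, rfl⟩
  choose fh fc hfc using h1
  refine ⟨fh, fc, hfc, fun i => ⟨fun v w h => ?_, fun v w h => ?_, fun v => ?_⟩⟩
  · have : f ⟨i, v⟩ = f ⟨i, w⟩ := by rw [hfc, hfc, h]
    exact (IsEmb_incl i).inj (hf.inj this)
  · have := hf.adj _ _ ((Sg_adj i v w).2 h)
    rw [hfc, hfc, Sg_adj] at this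
    exact this
  · have := hf.col ⟨i, v⟩
    rw [hfc] at this
    exact this

lemma Sg_le_of_inj (e : I → J) (he : Function.Injective e) (h : ∀ i, Le (C i) (D (e i))) :
    Le (Sg I C) (Sg J D) := by
  choose f hf using h
  refine ⟨fun x => ⟨e x.1, f x.1 x.2⟩, ?_, ?_, ?_⟩
  · rintro ⟨i, v⟩ ⟨j, w⟩ h
    have h1 : i = j := he (Sigma.mk.inj h).1
    subst h1
    have h2 := eq_of_heq (Sigma.mk.inj h).2
    exact congrArg (Sigma.mk i) ((hf i).inj h2)
  · rintro _ _ ⟨i, v, w, h⟩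
    exact (Sg_adj (C := D) (e i) _ _).2 ((hf i).adj _ _ h)
  · rintro ⟨i, v⟩
    exact (hf i).col v

lemma Sg_iso_of_equiv (e : I ≃ J) (h : ∀ i, Iso (C i) (D (e i))) : Iso (Sg I C) (Sg J D) := by
  choose f hf using h
  refine ⟨_, iso_of_bij (A := Sg I C) (B := Sg J D) (fun x => ⟨e x.1, f x.1 x.2⟩) ⟨?_, ?_⟩ ?_ ?_⟩
  · rintro ⟨i, v⟩ ⟨j, w⟩ h
    have h1 : i = j := e.injective (Sigma.mk.inj h).1
    subst h1
    have h2 := eq_of_heq (Sigma.mk.inj h).2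
    exact congrArg (Sigma.mk i) ((f i).injective h2)
  · rintro ⟨j, w⟩
    obtain ⟨i, rfl⟩ := e.surjective j
    obtain ⟨v, rfl⟩ := (f i).surjective w
    exact ⟨⟨i, v⟩, rfl⟩
  · rintro ⟨i, v⟩ ⟨j, w⟩
    constructor
    · rintro ⟨i, v, w, h⟩
      exact (Sg_adj (C := D) (e i) _ _).2 ((hf i).1.adj _ _ h)
    · intro h
      have h1 : i = j := e.injective (Sg_idx h)
      subst h1
      rw [Sg_adj] at h ⊢
      exact ((hf i).adj _ _).2 h
  · rintro ⟨i, v⟩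
    exact (hf i).col v

lemma Sg_iso_split (hC : ∀ i, Conn (C i)) (hD : ∀ j, Conn (D j)) (h : Iso (Sg I C) (Sg J D)) :
    ∃ e : I ≃ J, ∀ i, Iso (C i) (D (e i)) := by
  obtain ⟨e, he⟩ := h
  obtain ⟨fh, fc, hf, hfe⟩ := Sg_split hC he.1
  obtain ⟨gh, gc, hg, hge⟩ := Sg_split hD he.2
  have hgf : ∀ i, gh (fh i) = i := by
    intro i
    obtain ⟨⟨v⟩, -⟩ := hC i
    have : e.symm (e ⟨i, v⟩) = ⟨i, v⟩ := e.symm_apply_apply _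
    rw [hf, hg] at this
    exact (Sigma.mk.inj this).1
  have hfg : ∀ i, fh (gh i) = i := by
    intro i
    obtain ⟨⟨v⟩, -⟩ := hD i
    have : e (e.symm ⟨i, v⟩) = ⟨i, v⟩ := e.apply_symm_apply _
    rw [hg, hf] at this
    exact (Sigma.mk.inj this).1
  refine ⟨⟨fh, gh, hgf, hfg⟩, fun i => ?_⟩
  refine ⟨_, iso_of_bij (fc i) ⟨(hfe i).inj, fun w => ?_⟩ (fun x y => ?_) (fun x => ?_)⟩
  · obtain ⟨⟨i', v⟩, hv⟩ := e.surjective ⟨fh i, w⟩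
    rw [hf] at hv
    have h1 : i' = i := by
      rw [← hgf i', ← hgf i, (Sigma.mk.inj hv).1]
    subst h1
    exact ⟨v, eq_of_heq (Sigma.mk.inj hv).2⟩
  · have := he.adj ⟨i, x⟩ ⟨i, y⟩
    rw [hf, hf, Sg_adj, Sg_adj] at this
    exact this
  · have := he.col ⟨i, x⟩
    rw [hf] at this
    exact this

/-- Every graph is the disjoint union of connected ones. -/
lemma exists_Sg (A : CG L) : ∃ (I : Type u) (C : I → CG L), (∀ i, Conn (C i)) ∧ Iso A (Sg I C) := by
  let m : A.V → A.g.ConnectedComponent := A.g.connectedComponentMk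
  let C : A.g.ConnectedComponent → CG L := fun i =>
    ⟨{v // m v = i}, A.g.comap Subtype.val, fun v => A.c v.1⟩
  refine ⟨A.g.ConnectedComponent, C, ?_, ?_⟩
  · intro i
    induction i using SimpleGraph.ConnectedComponent.ind with
    | h v =>
    refine ⟨⟨⟨v, rfl⟩⟩, ?_⟩
    rintro ⟨x, hx⟩ ⟨y, hy⟩
    have hr : ReflTransGen A.g.Adj x y :=
      (SimpleGraph.reachable_iff_reflTransGen x y).1
        (SimpleGraph.ConnectedComponent.exact (hx.trans hy.symm))
    revert hy
    induction hr with
    | refl => exact fun _ => .refl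
    | @tail b c h1 h2 ih =>
      intro hy
      have hb : m b = m c := SimpleGraph.ConnectedComponent.sound h2.reachable
      have hb' : m x = m b :=
        SimpleGraph.ConnectedComponent.sound ((SimpleGraph.reachable_iff_reflTransGen x b).2 h1)
      exact (ih (hb'.symm.trans hx)).tail h2
  · refine Iso.symm ⟨_, iso_of_bij (A := Sg _ C) (B := A) (fun x => x.2.1) ⟨?_, ?_⟩ ?_ ?_⟩
    · rintro ⟨i, v, rfl⟩ ⟨j, w, rfl⟩ h
      dsimp at h
      subst h
      rfl
    · intro v
      exact ⟨⟨m v, v, rfl⟩, rfl⟩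
    · rintro ⟨i, v, hv⟩ ⟨j, w, hw⟩
      constructor
      · intro h
        change SgAdj C _ _ at h
        cases h with
        | mk i v w h => exact h
      · intro h
        have h : A.g.Adj v w := h
        have hij : i = j := by
          rw [← hv, ← hw]
          exact SimpleGraph.ConnectedComponent.sound h.reachable
        subst hij
        rw [Sg_adj]
        exact h
    · rintro ⟨i, v, rfl⟩
      rfl

/-- Adding one more piece. -/
abbrev opt (p : CG L) (C : I → CG L) : Option I → CG L := fun o => o.elim p C

lemma opt_mono (p : CG L) (h : Le (Sg I C) (Sg J D)) :
    Le (Sg (Option I) (opt p C)) (Sg (Option J) (opt p D)) := by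
  obtain ⟨f, hf⟩ := h
  have hsome : IsEmb (Sg J D) (Sg (Option J) (opt p D)) (fun y => ⟨some y.1, y.2⟩) := by
    refine ⟨?_, ?_, fun _ => subset_rfl⟩
    · rintro ⟨i, v⟩ ⟨j, w⟩ h
      have h1 : i = j := Option.some_injective _ (Sigma.mk.inj h).1
      subst h1
      exact congrArg (Sigma.mk i) (eq_of_heq (Sigma.mk.inj h).2)
    · rintro _ _ ⟨i, v, w, h⟩
      exact (Sg_adj (C := opt p D) (some i) _ _).2 h
  refine ⟨fun x => match x with
    | ⟨none, v⟩ => ⟨none, v⟩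
    | ⟨some i, v⟩ => ⟨some (f ⟨i, v⟩).1, (f ⟨i, v⟩).2⟩, ?_, ?_, ?_⟩
  · rintro ⟨_ | i, v⟩ ⟨_ | j, w⟩ h
    · exact congrArg (Sigma.mk none) (eq_of_heq (Sigma.mk.inj h).2)
    · exact absurd (Sigma.mk.inj h).1 (by simp)
    · exact absurd (Sigma.mk.inj h).1 (by simp)
    · have := hf.inj (hsome.inj h)
      cases this
      rfl
  · rintro _ _ ⟨_ | i, v, w, h⟩
    · exact (Sg_adj (C := opt p D) none _ _).2 h
    · exact hsome.adj _ _ (hf.adj _ _ ((Sg_adj i v w).2 h))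
  · rintro ⟨_ | i, v⟩
    · exact subset_rfl
    · exact hf.col ⟨i, v⟩

end cg
end Tw

namespace Tw
open Relation Cardinal

section multi
variable {L : Type u}

/-- There are infinitely many pairwise non-isomorphic graphs satisfying `ok`
that are mutually embeddable with `A`. -/
def Many (A : CG L) (ok : CG L → Prop) : Prop :=
  ∃ F : ℕ → CG L, (∀ n, ok (F n)) ∧ (∀ n, Eqv A (F n)) ∧ ∀ n m, n ≠ m → ¬ Iso (F n) (F m)

def Good (B : Set (CG L)) (X : CG L) : Prop :=
  ∃ (I : Type u) (C : I → CG L), X = Sg I C ∧ ∀ i, Conn (C i) ∧ ∃ b ∈ B, Le b (C i)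

lemma Many.of_eqv {A B : CG L} {ok ok' : CG L → Prop} (h : Eqv A B) (hok : ∀ X, ok X → ok' X)
    (hB : Many B ok) : Many A ok' := by
  obtain ⟨F, h1, h2, h3⟩ := hB
  exact ⟨F, fun n => hok _ (h1 n), fun n => h.trans (h2 n), h3⟩

lemma Good.mono {B B' : Set (CG L)} (h : B ⊆ B') (X : CG L) (hX : Good B X) : Good B' X := by
  obtain ⟨I, C, rfl, hC⟩ := hX
  refine ⟨I, C, rfl, fun i => ⟨(hC i).1, ?_⟩⟩
  obtain ⟨b, hb, hl⟩ := (hC i).2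
  exact ⟨b, h hb, hl⟩

variable {I J : Type u} {C : I → CG L} {D : J → CG L}

lemma many_swap (hC : ∀ i, Conn (C i)) (i0 : I) (hm : Many (C i0) Conn) :
    Many (Sg I C) (Good (Set.range C)) := by
  classical
  obtain ⟨Q, h1, h2, h3⟩ := hm
  let F : ℕ → I → CG L := fun n i => if Eqv (C i) (C i0) then Q n else C i
  have hF : ∀ n i, Eqv (C i) (F n i) := by
    intro n i
    by_cases h : Eqv (C i) (C i0)
    · simp only [F, if_pos h]; exact h.trans (h2 n)
    · simp only [F, if_neg h]; exact Eqv.refl _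
  have hFc : ∀ n i, Conn (F n i) := by
    intro n i
    by_cases h : Eqv (C i) (C i0)
    · simp only [F, if_pos h]; exact h1 n
    · simp only [F, if_neg h]; exact hC i
  refine ⟨fun n => Sg I (F n), fun n => ⟨I, F n, rfl, fun i => ⟨hFc n i, C i, ⟨i, rfl⟩, (hF n i).1⟩⟩,
    fun n => ⟨Sg_le_of_inj id Function.injective_id fun i => (hF n i).1,
      Sg_le_of_inj id Function.injective_id fun i => (hF n i).2⟩, ?_⟩
  intro n m hnm hiso
  obtain ⟨e, he⟩ := Sg_iso_split (hFc n) (hFc m) hiso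
  have := he i0
  have e1 : F n i0 = Q n := if_pos (Eqv.refl _)
  rw [e1] at this
  by_cases h : Eqv (C (e i0)) (C i0)
  · simp only [F, if_pos h] at this
    exact h3 n m hnm this
  · simp only [F, if_neg h] at this
    exact h (this.eqv.symm.trans (h2 n).symm)

lemma Sg_lift {A : CG L} {u : A.V → (Sg I C).V} (hu : IsEmb A (Sg I C) u) {i : I}
    (hi : ∀ x, (u x).1 = i) : ∃ u', IsEmb A (C i) u' ∧ ∀ x, u x = ⟨i, u' x⟩ := by
  have : ∀ x, ∃ w : (C i).V, u x = ⟨i, w⟩ := by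
    intro x
    rw [← hi x]
    exact ⟨_, rfl⟩
  choose u' hu' using this
  refine ⟨u', ⟨fun x y h => hu.inj (by rw [hu', hu', h]), fun x y h => ?_, fun x => ?_⟩, hu'⟩
  · have := hu.adj x y h
    rw [hu', hu', Sg_adj] at this
    exact this
  · have := hu.col x
    rw [hu'] at this
    exact this

lemma Sg_restrict {A : CG L} {u : A.V → (Sg I C).V} (hu : IsEmb A (Sg I C) u) (P : I → Prop)
    (hi : ∀ x, P (u x).1) : Le A (Sg {i // P i} (fun i => C i)) := by
  refine ⟨fun x => ⟨⟨(u x).1, hi x⟩, (u x).2⟩, ⟨fun x y h => hu.inj ?_, fun x y h => ?_, fun x => ?_⟩⟩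
  · have := congrArg (fun z : (Sg {i // P i} (fun i => C i)).V => (⟨z.1.1, z.2⟩ : (Sg I C).V)) h
    exact this
  · have h' := hu.adj x y h
    have key : ∀ a b : (Sg I C).V, ∀ (ha : P a.1) (hb : P b.1), SgAdj C a b →
        SgAdj (fun i : {i // P i} => C i) ⟨⟨a.1, ha⟩, a.2⟩ ⟨⟨b.1, hb⟩, b.2⟩ := by
      rintro _ _ ha hb ⟨i, v, w, h⟩
      exact SgAdj.mk (C := fun i : {i // P i} => C i) ⟨i, ha⟩ v w h
    exact key _ _ _ _ h'
  · exact hu.col x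

lemma Sg_emb_of_inj (e : I → J) (he : Function.Injective e) (h : ∀ i, Le (C i) (D (e i))) :
    ∃ f, IsEmb (Sg I C) (Sg J D) f ∧ ∀ x, (f x).1 = e x.1 := by
  choose f hf using h
  refine ⟨fun x => ⟨e x.1, f x.1 x.2⟩, ⟨?_, ?_, ?_⟩, fun _ => rfl⟩
  · rintro ⟨i, v⟩ ⟨j, w⟩ h
    have h1 : i = j := he (Sigma.mk.inj h).1
    subst h1
    have h2 := eq_of_heq (Sigma.mk.inj h).2
    exact congrArg (Sigma.mk i) ((hf i).inj h2)
  · rintro _ _ ⟨i, v, w, h⟩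
    exact (Sg_adj (C := D) (e i) _ _).2 ((hf i).adj _ _ h)
  · rintro ⟨i, v⟩
    exact (hf i).col v

lemma double_idx {p : CG L} (hp : Conn p) (hr : p.g.IsRayless) {u v : p.V → (Sg I C).V}
    (hu : IsEmb p (Sg I C) u) (hv : IsEmb p (Sg I C) v) {i : I} (hui : ∀ x, (u x).1 = i)
    (hvi : ∀ x, (v x).1 = i) (hi : Le (C i) p) (hd : ∀ x y, u x ≠ v y) : False := by
  obtain ⟨u', hu', h1⟩ := Sg_lift hu hui
  obtain ⟨v', hv', h2⟩ := Sg_lift hv hvi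
  obtain ⟨t, ht⟩ := hi
  refine no_double hp hr (ht.comp hu') (ht.comp hv') fun x y h => hd x y ?_
  rw [h1, h2, ht.inj h]

lemma inj_idx {p : CG L} (hp : Conn p) (hr : p.g.IsRayless) {f : (Sg J D).V → (Sg I C).V}
    (hf : IsEmb (Sg J D) (Sg I C) f) {fh : J → I} (hfh : ∀ j v, (f ⟨j, v⟩).1 = fh j)
    {j j' : J} (hj : Iso (D j) p) (hj' : Iso (D j') p) (h : fh j = fh j')
    (hi : Iso (C (fh j)) p) : j = j' := by
  by_contra hne
  obtain ⟨s, hs⟩ := hj.eqv.2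
  obtain ⟨s', hs'⟩ := hj'.eqv.2
  refine double_idx hp hr (hf.comp ((IsEmb_incl j).comp hs)) (hf.comp ((IsEmb_incl j').comp hs'))
    (i := fh j) (fun x => hfh _ _) (fun x => (hfh _ _).trans h.symm) hi.eqv.1 ?_
  intro x y hxy
  exact hne (Sigma.mk.inj (hf.inj hxy)).1

lemma many_fam {A : CG L} {B : Set (CG L)} {p : CG L} (hC : ∀ i, Conn (C i)) (hp : Conn p)
    (hfin : Finite {i // Iso (C i) p})
    (heq : ∀ n : ℕ, Eqv A (Sg (I ⊕ ULift.{u} (Fin (n+1))) (Sum.elim C fun _ => p)))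
    (hB : ∀ i, ∃ b ∈ B, Le b (C i)) (hBp : ∃ b ∈ B, Le b p) : Many A (Good B) := by
  have hc : ∀ n : ℕ, ∀ x : I ⊕ ULift.{u} (Fin (n+1)), Conn (Sum.elim C (fun _ => p) x) := by
    rintro n (i | t)
    · exact hC i
    · exact hp
  refine ⟨_, fun n => ⟨_, _, rfl, ?_⟩, heq, ?_⟩
  · rintro (i | t)
    · exact ⟨hC i, hB i⟩
    · exact ⟨hp, hBp⟩
  · intro n m hnm hiso
    obtain ⟨e, he⟩ := Sg_iso_split (hc n) (hc m) hiso
    have card : ∀ n : ℕ, Nat.card {x : I ⊕ ULift.{u} (Fin (n+1)) //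
        Iso (Sum.elim C (fun _ => p) x) p} = Nat.card {i // Iso (C i) p} + (n + 1) := by
      intro n
      haveI h1 : Finite {a // Iso (Sum.elim C (fun _ => p) (Sum.inl a : I ⊕ ULift.{u} (Fin (n+1)))) p} :=
        hfin
      rw [Nat.card_congr (Equiv.subtypeSum), Nat.card_sum]
      congr 1
      have h2 : ∀ b : ULift.{u} (Fin (n+1)),
        Iso (Sum.elim C (fun _ => p) (Sum.inr b : I ⊕ ULift.{u} (Fin (n+1)))) p := fun _ => Iso.refl p
      exact (Nat.card_congr (Equiv.subtypeUnivEquiv h2)).trans (by simp)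
    have h2 := Nat.card_congr (e.subtypeEquiv (p := fun x => Iso (Sum.elim C (fun _ => p) x) p)
      (q := fun x => Iso (Sum.elim C (fun _ => p) x) p)
      fun x => ⟨fun h => (he x).symm.trans h, fun h => (he x).trans h⟩)
    rw [card, card] at h2
    omega

lemma add_many {p : CG L} (h : Le (Sg (Option I) (opt p C)) (Sg I C)) (T : Type u) [Finite T] :
    Le (Sg (I ⊕ T) (Sum.elim C fun _ => p)) (Sg I C) := by
  induction T using Finite.induction_empty_option with
  | of_equiv e ih =>
    refine Le.trans (Sg_le_of_inj (Sum.map id e.symm)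
      (Sum.map_injective.2 ⟨Function.injective_id, e.symm.injective⟩) ?_) ih
    rintro (i | t) <;> exact Le.refl _
  | h_empty =>
    refine Sg_le_of_inj (fun x => x.elim id PEmpty.elim) ?_ ?_
    · rintro (i | ⟨⟨⟩⟩) (j | ⟨⟨⟩⟩) h
      exact congrArg Sum.inl h
    · rintro (i | ⟨⟨⟩⟩)
      exact Le.refl _
  | @h_option T _ ih =>
    refine Le.trans (Sg_le_of_inj (J := Option (I ⊕ T)) (D := opt p (Sum.elim C fun _ => p))
      (fun x => x.elim (fun i => some (Sum.inl i)) (fun o => o.elim none (fun t => some (Sum.inr t))))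
      ?_ ?_) (Le.trans (opt_mono p ih) h)
    · rintro (i | _ | t) (j | _ | t') h <;> simp_all
    · rintro (i | _ | t) <;> exact Le.refl _

lemma add_of_nonper {f : (Sg J D).V → (Sg J D).V} (hf : IsEmb (Sg J D) (Sg J D) f)
    {fh : J → J} (hfh : ∀ x, (f x).1 = fh x.1) (d : J) (hd : ∀ k, fh^[k+1] d ≠ d) :
    Le (Sg (Option J) (opt (D d) D)) (Sg J D) := by
  classical
  let T : Set J := {x | fh x = d ∨ ∃ k, fh^[k] d = x}
  have hT : ∀ x ∈ T, fh x ∈ T := by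
    rintro x (h | ⟨k, rfl⟩)
    · exact Or.inr ⟨0, h.symm⟩
    · exact Or.inr ⟨k+1, Function.iterate_succ_apply' _ _ _⟩
  let g : (Sg J D).V → (Sg J D).V := fun x => if x.1 ∈ T then f (f x) else f x
  have hg : IsEmb (Sg J D) (Sg J D) g := by
    have aux : ∀ x y, x.1 ∈ T → y.1 ∉ T → f (f x) ≠ f y := by
      intro x y hx hy h
      apply hy
      rw [← hf.inj h, hfh]
      exact hT _ hx
    refine ⟨fun x y h => ?_, fun x y h => ?_, fun x => ?_⟩
    · by_cases hx : x.1 ∈ T <;> by_cases hy : y.1 ∈ T <;> simp only [g, hx, hy, if_true, if_false] at h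
      · exact hf.inj (hf.inj h)
      · exact absurd h (aux x y hx hy)
      · exact absurd h.symm (aux y x hy hx)
      · exact hf.inj h
    · have hxy : x.1 = y.1 := Sg_idx h
      by_cases hx : x.1 ∈ T
      · have hy : y.1 ∈ T := hxy ▸ hx
        simp only [g, hx, hy, if_true]
        exact hf.adj _ _ (hf.adj _ _ h)
      · have hy : y.1 ∉ T := hxy ▸ hx
        simp only [g, hx, hy, if_false]
        exact hf.adj _ _ h
    · by_cases hx : x.1 ∈ T
      · have e1 : g x = f (f x) := if_pos hx
        rw [e1]
        exact (hf.col x).trans (hf.col _)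
      · have e1 : g x = f x := if_neg hx
        rw [e1]
        exact hf.col x
  have hgd : ∀ x, (g x).1 ≠ d := by
    intro x h
    by_cases hx : x.1 ∈ T <;> simp only [g, hx, if_true, if_false] at h
    · rw [hfh, hfh] at h
      rcases hx with hx | ⟨k, hk⟩
      · rw [hx] at h
        exact hd 0 h
      · rw [← hk, ← Function.iterate_succ_apply' fh, ← Function.iterate_succ_apply' fh] at h
        exact hd (k+1) h
    · rw [hfh] at h
      exact hx (Or.inl h)
  refine ⟨fun x => match x with
    | ⟨none, v⟩ => ⟨d, v⟩
    | ⟨some j, v⟩ => g ⟨j, v⟩, ?_, ?_, ?_⟩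
  · rintro ⟨_ | i, v⟩ ⟨_ | j, w⟩ h
    · exact congrArg (Sigma.mk none) (eq_of_heq (Sigma.mk.inj h).2)
    · exact absurd (congrArg Sigma.fst h).symm (hgd _)
    · exact absurd (congrArg Sigma.fst h) (hgd _)
    · have := hg.inj h
      cases this
      rfl
  · rintro _ _ ⟨_ | i, v, w, h⟩
    · exact (Sg_adj (C := D) d _ _).2 h
    · exact hg.adj _ _ ((Sg_adj i v w).2 h)
  · rintro ⟨_ | i, v⟩
    · exact subset_rfl
    · exact hg.col ⟨i, v⟩

lemma many_finite {p : CG L} (hC : ∀ i, Conn (C i)) (hD : ∀ j, Conn (D j)) (hp : Conn p)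
    (hr : p.g.IsRayless) (hrig : ∀ A, Conn A → Eqv A p → Iso A p)
    (hlt : #{i // Iso (C i) p} < #{j // Iso (D j) p}) (hCD : Le (Sg I C) (Sg J D))
    (hDC : Le (Sg J D) (Sg I C)) (hfin : Finite {i // Iso (C i) p}) :
    Many (Sg I C) (Good (Set.range C ∪ Set.range D)) := by
  obtain ⟨φ, hφ⟩ := id hCD
  obtain ⟨ψ, hψ⟩ := id hDC
  obtain ⟨φh, φc, h1, h1e⟩ := Sg_split hC hφ
  obtain ⟨ψh, ψc, h2, h2e⟩ := Sg_split hD hψ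
  obtain ⟨d, hd, hdn⟩ : ∃ d, Iso (D d) p ∧ ¬ Iso (C (ψh d)) p := by
    by_contra hcon
    push Not at hcon
    refine not_le_of_gt hlt ⟨⟨fun j => ⟨ψh j.1, hcon _ j.2⟩, ?_⟩⟩
    rintro ⟨j, hj⟩ ⟨j', hj'⟩ h
    apply Subtype.ext
    exact inj_idx hp hr hψ (fun j v => by rw [h2]) hj hj' (congrArg Subtype.val h) (hcon _ hj)
  have hadd : Le (Sg (Option J) (opt p D)) (Sg J D) := by
    refine Le.trans (Sg_le_of_inj (D := opt (D d) D) id Function.injective_id ?_)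
      (add_of_nonper (hφ.comp hψ) (fh := fun j => φh (ψh j)) ?_ d ?_)
    · rintro (_ | j)
      · exact hd.eqv.2
      · exact Le.refl _
    · rintro ⟨j, v⟩
      rw [h2, h1]
    · intro k hk
      have hle : ∀ k j, Le (D j) (D ((fun j => φh (ψh j))^[k] j)) := by
        intro k
        induction k with
        | zero => exact fun j => Le.refl _
        | succ k ih =>
          intro j
          rw [Function.iterate_succ_apply]
          exact Le.trans ⟨_, h2e j⟩ (Le.trans ⟨_, h1e _⟩ (ih _))
      apply hdn
      refine hrig _ (hC _) ⟨?_, hd.eqv.2.trans ⟨_, h2e d⟩⟩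
      have h3 := hle k (φh (ψh d))
      rw [Function.iterate_succ_apply] at hk
      rw [hk] at h3
      exact Le.trans ⟨_, h1e _⟩ (h3.trans hd.eqv.1)
  have hadd' : Le (Sg (Option I) (opt p C)) (Sg I C) :=
    (opt_mono p hCD).trans (hadd.trans hDC)
  refine many_fam hC hp hfin (fun n => ⟨Sg_le_of_inj Sum.inl Sum.inl_injective fun i => Le.refl _,
    add_many hadd' _⟩) (fun i => ⟨C i, Or.inl ⟨i, rfl⟩, Le.refl _⟩) ⟨D d, Or.inr ⟨d, rfl⟩, hd.eqv.1⟩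

lemma many_infinite {p : CG L} (hC : ∀ i, Conn (C i)) (hD : ∀ j, Conn (D j)) (hp : Conn p)
    (hr : p.g.IsRayless)
    (hlt : #{i // Iso (C i) p} < #{j // Iso (D j) p}) (hCD : Le (Sg I C) (Sg J D))
    (hDC : Le (Sg J D) (Sg I C)) (hinf : Infinite {i // Iso (C i) p}) :
    Many (Sg I C) (Good (Set.range C ∪ Set.range D)) := by
  classical
  obtain ⟨φ, hφ⟩ := id hCD
  obtain ⟨ψ, hψ⟩ := id hDC
  obtain ⟨ψh, ψc, h2, h2e⟩ := Sg_split hD hψ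
  have hI : ℵ₀ ≤ #{i // Iso (C i) p} := Cardinal.aleph0_le_mk _
  obtain ⟨e⟩ : Nonempty ({j // Iso (D j) p} ⊕ {j // Iso (D j) p} ≃ {j // Iso (D j) p}) := by
    rw [← Cardinal.eq, ← Cardinal.add_def]
    exact Cardinal.add_eq_self (hI.trans hlt.le)
  -- a self-embedding of the second graph which misses many copies of `p`
  obtain ⟨θ, hθ, hθi⟩ := Sg_emb_of_inj (C := D) (D := D)
    (fun j => if h : Iso (D j) p then (e (Sum.inl ⟨j, h⟩)).1 else j) (by
      intro j j' h
      by_cases hj : Iso (D j) p <;> by_cases hj' : Iso (D j') p <;>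
        simp only [hj, hj', dif_pos, dif_neg, not_false_eq_true] at h
      · have := Sum.inl_injective (e.injective (Subtype.ext h))
        exact congrArg Subtype.val this
      · exact absurd (h ▸ (e (Sum.inl ⟨j, hj⟩)).2) hj'
      · exact absurd (h ▸ (e (Sum.inl ⟨j', hj'⟩)).2) hj
      · exact h) (by
      intro j
      by_cases hj : Iso (D j) p
      · simp only [hj, dif_pos]
        exact hj.eqv.1.trans (e (Sum.inl ⟨j, hj⟩)).2.eqv.2
      · simp only [hj, dif_neg, not_false_eq_true]
        exact Le.refl _)
  have hθr : ∀ x k, (θ x).1 ≠ (e (Sum.inr k)).1 := by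
    intro x k h
    rw [hθi] at h
    by_cases hj : Iso (D x.1) p
    · simp only [hj, dif_pos] at h
      exact absurd (e.injective (Subtype.ext h)) (by simp)
    · simp only [hj, dif_neg, not_false_eq_true] at h
      exact hj (h ▸ (e (Sum.inr k)).2)
  have hf := hψ.comp (hθ.comp hφ)
  set f := fun x => ψ (θ (φ x)) with hfdef
  -- enough room outside the copies of `p`
  obtain ⟨m⟩ : Nonempty ({i // Iso (C i) p} ↪
      {k : {j // Iso (D j) p} // ¬ Iso (C (ψh (e (Sum.inr k)).1)) p}) := by
    by_contra hcon
    have hlt2 : #{k : {j // Iso (D j) p} // ¬ Iso (C (ψh (e (Sum.inr k)).1)) p} <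
        #{i // Iso (C i) p} := by
      by_contra hle
      exact hcon (not_lt.1 hle)
    have hle : #{k : {j // Iso (D j) p} // Iso (C (ψh (e (Sum.inr k)).1)) p} ≤
        #{i // Iso (C i) p} := by
      refine ⟨⟨fun k => ⟨_, k.2⟩, ?_⟩⟩
      rintro ⟨k, hk⟩ ⟨k', hk'⟩ h
      apply Subtype.ext
      have := inj_idx hp hr hψ (fun j v => by rw [h2]) (e (Sum.inr k)).2 (e (Sum.inr k')).2
        (congrArg Subtype.val h) hk
      exact Sum.inr_injective (e.injective (Subtype.ext this))
    have hsum := Cardinal.mk_sum_compl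
      {k : {j // Iso (D j) p} | Iso (C (ψh (e (Sum.inr k)).1)) p}
    refine not_le_of_gt hlt ?_
    rw [← hsum]
    exact (add_le_add hle hlt2.le).trans (Cardinal.add_eq_self hI).le
  have hs : ∀ i, ∃ s : (C i).V → (Sg I C).V, ∀ h : Iso (C i) p, IsEmb (C i) (Sg I C) s ∧
      ∀ v, ∃ w, s v = ψ ⟨(e (Sum.inr (m ⟨i, h⟩).1)).1, w⟩ := by
    intro i
    by_cases h : Iso (C i) p
    swap
    · exact ⟨fun v => ⟨i, v⟩, fun h' => absurd h' h⟩
    obtain ⟨t, ht⟩ := h.eqv.1.trans (e (Sum.inr (m ⟨i, h⟩).1)).2.eqv.2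
    exact ⟨_, fun h => ⟨hψ.comp ((IsEmb_incl _).comp ht), fun v => ⟨t v, rfl⟩⟩⟩
  choose s hs using hs
  let κ : (Sg I C).V → (Sg I C).V := fun x => if Iso (C x.1) p then s x.1 x.2 else x
  have hκ1 : ∀ x y, (Sg I C).g.Adj x y → (Sg I C).g.Adj (κ x) (κ y) := by
    rintro _ _ ⟨i, v, w, h⟩
    by_cases hi : Iso (C i) p
    · simp only [κ, hi, if_true]
      exact (hs i hi).1.adj _ _ h
    · simp only [κ, hi, if_false]
      exact (Sg_adj i v w).2 h
  have hκ2 : ∀ x, (Sg I C).c x ⊆ (Sg I C).c (κ x) := by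
    rintro ⟨i, v⟩
    by_cases hi : Iso (C i) p
    · have e1 : κ ⟨i, v⟩ = s i v := if_pos hi
      rw [e1]
      exact (hs i hi).1.col v
    · have e1 : κ ⟨i, v⟩ = ⟨i, v⟩ := if_neg hi
      rw [e1]
  have hdis : ∀ i (_ : Iso (C i) p) v x, s i v ≠ f x := by
    intro i hi v x h
    obtain ⟨w, hw⟩ := (hs i hi).2 v
    rw [hw] at h
    exact hθr _ _ (congrArg Sigma.fst (hψ.inj h)).symm
  have hsame : ∀ a b : (Sg I C).V, Iso (C a.1) p → s a.1 a.2 = s b.1 b.2 → a.1 = b.1 → a = b := by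
    rintro ⟨i, v⟩ ⟨j, w⟩ hx h h6
    dsimp only at h6
    subst h6
    exact congrArg (Sigma.mk i) ((hs i hx).1.inj h)
  have hg : IsEmb (Sg I C) (Sg I C) (fun x => κ (f x)) := by
    refine ⟨fun x y h => ?_, fun x y h => hκ1 _ _ (hf.adj _ _ h),
      fun x => (hf.col x).trans (hκ2 _)⟩
    by_cases hx : Iso (C (f x).1) p <;> by_cases hy : Iso (C (f y).1) p <;>
      simp only [κ, hx, hy, if_true, if_false] at h
    · apply hf.inj
      obtain ⟨w, hw⟩ := (hs _ hx).2 (f x).2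
      obtain ⟨w', hw'⟩ := (hs _ hy).2 (f y).2
      have h3 := h
      rw [hw, hw'] at h3
      have h4 := congrArg Sigma.fst (hψ.inj h3)
      have h5 := m.injective (Subtype.ext (Sum.inr_injective (e.injective (Subtype.ext h4))))
      have h6 : (f x).1 = (f y).1 := congrArg Subtype.val h5
      exact hsame _ _ hx h h6
    · exact absurd h (hdis _ hx _ _)
    · exact absurd h.symm (hdis _ hy _ _)
    · exact hf.inj h
  have hgi : ∀ x, ¬ Iso (C (κ (f x)).1) p := by
    intro x
    by_cases hx : Iso (C (f x).1) p
    · simp only [κ, hx, if_true]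
      obtain ⟨w, hw⟩ := (hs _ hx).2 (f x).2
      rw [hw, h2]
      exact (m ⟨_, hx⟩).2
    · have e1 : κ (f x) = f x := if_neg hx
      rw [e1]
      exact hx
  have hle := Sg_restrict hg (fun i => ¬ Iso (C i) p) hgi
  obtain ⟨j0, hj0⟩ : ∃ j, Iso (D j) p := by
    by_contra hcon
    push Not at hcon
    haveI : IsEmpty {j // Iso (D j) p} := ⟨fun j => hcon _ j.2⟩
    rw [Cardinal.mk_eq_zero {j // Iso (D j) p}] at hlt
    exact absurd hlt (by simp)
  refine many_fam (C := fun i : {i // ¬ Iso (C i) p} => C i) (fun i => hC i) hp ?_ ?_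
    (fun i => ⟨C i, Or.inl ⟨i, rfl⟩, Le.refl _⟩) ⟨D j0, Or.inr ⟨j0, rfl⟩, hj0.eqv.1⟩
  · haveI : IsEmpty {i : {i // ¬ Iso (C i) p} // Iso (C i) p} := ⟨fun i => i.1.2 i.2⟩
    infer_instance
  · intro n
    refine ⟨hle.trans (Sg_le_of_inj Sum.inl Sum.inl_injective fun i => Le.refl _), ?_⟩
    obtain ⟨t⟩ : Nonempty (Fin (n+1) ↪ {i // Iso (C i) p}) :=
      ⟨(Fin.valEmbedding).trans (Infinite.natEmbedding _)⟩
    refine Sg_le_of_inj (Sum.elim Subtype.val fun k => (t k.down).1) ?_ ?_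
    · rintro (⟨i, hi⟩ | k) (⟨j, hj⟩ | k') h
      · exact congrArg Sum.inl (Subtype.ext h)
      · exact absurd (t k'.down).2 (by have h : i = (t k'.down).1 := h; rw [← h]; exact hi)
      · exact absurd (t k.down).2 (by have h : (t k.down).1 = j := h; rw [h]; exact hj)
      · exact congrArg Sum.inr (ULift.ext _ _ (t.injective (Subtype.ext h)))
    · rintro (⟨i, hi⟩ | k)
      · exact Le.refl _
      · exact (t k.down).2.eqv.2

lemma many_of_lt {p : CG L} (hC : ∀ i, Conn (C i)) (hD : ∀ j, Conn (D j))
    (hDr : ∀ j, (D j).g.IsRayless) (hrig : ∀ j A, Conn A → Eqv A (D j) → Iso A (D j))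
    (hlt : #{i // Iso (C i) p} < #{j // Iso (D j) p}) (hCD : Le (Sg I C) (Sg J D))
    (hDC : Le (Sg J D) (Sg I C)) :
    Many (Sg I C) (Good (Set.range C ∪ Set.range D)) := by
  obtain ⟨j0, hj0⟩ : ∃ j, Iso (D j) p := by
    by_contra hcon
    push Not at hcon
    haveI : IsEmpty {j // Iso (D j) p} := ⟨fun j => hcon _ j.2⟩
    rw [Cardinal.mk_eq_zero {j // Iso (D j) p}] at hlt
    exact absurd hlt (by simp)
  have hp := conn_of_iso hj0 (hD j0)
  have hr := rayless_of_le hj0.eqv.2 (hDr j0)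
  rcases finite_or_infinite {i // Iso (C i) p} with h | h
  · exact many_finite hC hD hp hr (fun A hA he =>
      (hrig j0 A hA (he.trans hj0.eqv.symm)).trans hj0) hlt hCD hDC h
  · exact many_infinite hC hD hp hr hlt hCD hDC h

lemma iso_of_card (h : ∀ p : CG L, #{i // Iso (C i) p} = #{j // Iso (D j) p}) :
    Iso (Sg I C) (Sg J D) := by
  let S : Setoid (CG L) := ⟨Iso, Iso.refl, Iso.symm, Iso.trans⟩
  have h1 : ∀ y : Quotient S, Nonempty ({i // Quotient.mk S (C i) = y} ≃
      {j // Quotient.mk S (D j) = y}) := by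
    intro y
    induction y using Quotient.ind with
    | _ p =>
    have e1 : ∀ A : CG L, Quotient.mk S A = Quotient.mk S p ↔ Iso A p := fun A => Quotient.eq
    simp only [e1]
    exact Cardinal.eq.1 (h p)
  choose e he using fun y => (h1 y).elim fun e => (⟨e, trivial⟩ : ∃ e : ({i // Quotient.mk S (C i) = y} ≃
      {j // Quotient.mk S (D j) = y}), True)
  let E : I ≃ J := (Equiv.sigmaFiberEquiv fun i => Quotient.mk S (C i)).symm.trans
    ((Equiv.sigmaCongrRight e).trans (Equiv.sigmaFiberEquiv fun j => Quotient.mk S (D j)))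
  refine Sg_iso_of_equiv E fun i => ?_
  have : Quotient.mk S (D (E i)) = Quotient.mk S (C i) := (e _ ⟨i, rfl⟩).2
  exact (Quotient.exact this).symm

theorem many_union (hC : ∀ i, Conn (C i)) (hD : ∀ j, Conn (D j))
    (hCr : ∀ i, (C i).g.IsRayless) (hDr : ∀ j, (D j).g.IsRayless)
    (hCm : ∀ i A, Conn A → Eqv A (C i) → ¬ Iso A (C i) → Many (C i) Conn)
    (hDm : ∀ j A, Conn A → Eqv A (D j) → ¬ Iso A (D j) → Many (D j) Conn)
    (he : Eqv (Sg I C) (Sg J D)) (hn : ¬ Iso (Sg I C) (Sg J D)) :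
    Many (Sg I C) (Good (Set.range C ∪ Set.range D)) := by
  by_cases h1 : ∀ i A, Conn A → Eqv A (C i) → Iso A (C i)
  swap
  · push Not at h1
    obtain ⟨i, A, hA, hA', hA''⟩ := h1
    exact (many_swap hC i (hCm i A hA hA' hA'')).of_eqv (Eqv.refl _)
      (Good.mono Set.subset_union_left)
  by_cases h2 : ∀ j A, Conn A → Eqv A (D j) → Iso A (D j)
  swap
  · push Not at h2
    obtain ⟨i, A, hA, hA', hA''⟩ := h2
    exact (many_swap hD i (hDm i A hA hA' hA'')).of_eqv he
      (Good.mono Set.subset_union_right)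
  have : ∃ p : CG L, #{i // Iso (C i) p} ≠ #{j // Iso (D j) p} := by
    by_contra hcon
    push Not at hcon
    exact hn (iso_of_card hcon)
  obtain ⟨p, hp⟩ := this
  rcases lt_or_gt_of_ne hp with h | h
  · exact many_of_lt hC hD hDr h2 h he.1 he.2
  · refine (many_of_lt hD hC hCr h1 h he.2 he.1).of_eqv he (Good.mono ?_)
    rw [Set.union_comm]

end multi
end Tw

namespace Tw
open Relation

section glue
variable {L K : Type u}

def GAdj (gK : SimpleGraph K) (F : CG (L ⊕ K)) : K ⊕ F.V → K ⊕ F.V → Prop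
  | .inl a, .inl b => gK.Adj a b
  | .inr v, .inr w => F.g.Adj v w
  | .inl k, .inr v => Sum.inr k ∈ F.c v
  | .inr v, .inl k => Sum.inr k ∈ F.c v

/-- Glue a labelled graph onto a fixed graph `gK`, following the labels. -/
abbrev Glue (gK : SimpleGraph K) (cK : K → Set L) (F : CG (L ⊕ K)) : CG L where
  V := K ⊕ F.V
  g := { Adj := GAdj gK F
         symm := ⟨by
          rintro (a | v) (b | w) h
          · exact gK.symm.symm _ _ h
          · exact h
          · exact h
          · exact F.g.symm.symm _ _ h⟩
         loopless := ⟨by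
          rintro (a | v) h
          · exact gK.loopless.irrefl _ h
          · exact F.g.loopless.irrefl _ h⟩ }
  c := Sum.elim cK (fun v => {l | Sum.inl l ∈ F.c v})

variable {gK : SimpleGraph K} {cK : K → Set L} {F F' : CG (L ⊕ K)}

lemma glue_emb {f : F.V → F'.V} (hf : IsEmb F F' f) :
    IsEmb (Glue gK cK F) (Glue gK cK F') (Sum.map id f) := by
  refine ⟨Sum.map_injective.2 ⟨Function.injective_id, hf.inj⟩, ?_, ?_⟩
  · rintro (a | v) (b | w) h
    · exact h
    · exact hf.col _ h
    · exact hf.col _ h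
    · exact hf.adj _ _ h
  · rintro (a | v) l h
    · exact h
    · exact hf.col _ h

lemma glue_iso {e : F.V ≃ F'.V} (he : IsIso F F' e) :
    IsIso (Glue gK cK F) (Glue gK cK F') (Equiv.sumCongr (Equiv.refl K) e) :=
  ⟨glue_emb he.1, glue_emb he.2⟩

lemma Iso.glue (h : Iso F F') : Iso (Glue gK cK F) (Glue gK cK F') := by
  obtain ⟨e, he⟩ := h
  exact ⟨_, glue_iso he⟩

lemma iso_of_glue {e : K ⊕ F.V ≃ K ⊕ F'.V} (he : IsIso (Glue gK cK F) (Glue gK cK F') e)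
    (hK : ∀ k, e (Sum.inl k) = Sum.inl k) : Iso F F' := by
  have h1 : ∀ v, ∃ w, e (Sum.inr v) = Sum.inr w := by
    intro v
    rcases h : e (Sum.inr v) with k | w
    · rw [← hK k] at h
      exact absurd (e.injective h) (by simp)
    · exact ⟨w, rfl⟩
  choose f hf using h1
  refine ⟨_, iso_of_bij f ⟨fun v w h => ?_, fun w => ?_⟩ (fun x y => ?_) (fun x => ?_)⟩
  · exact Sum.inr_injective (e.injective (by rw [hf, hf, h]))
  · obtain ⟨k | v, hv⟩ := e.surjective (Sum.inr w)
    · rw [hK] at hv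
      exact absurd hv (by simp)
    · exact ⟨v, Sum.inr_injective (by rw [← hf, hv])⟩
  · have := he.adj (Sum.inr x) (Sum.inr y)
    rw [hf, hf] at this
    exact this
  · ext (l | k)
    · have := he.col (Sum.inr x)
      rw [hf] at this
      exact Set.ext_iff.1 this l
    · have := he.adj (Sum.inr x) (Sum.inl k)
      rw [hf, hK] at this
      exact this

/-- What remains of `G` outside the image of `ι`. -/
abbrev rest (G : CG L) (ι : K → G.V) : CG (L ⊕ K) where
  V := {v // v ∉ Set.range ι}
  g := G.g.comap Subtype.val
  c := fun v => {x | Sum.elim (fun l => l ∈ G.c v.1) (fun k => G.g.Adj (ι k) v.1) x}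

lemma decomp (G : CG L) {ι : K → G.V} (hι : Function.Injective ι)
    (hg : ∀ a b, gK.Adj a b ↔ G.g.Adj (ι a) (ι b)) (hc : ∀ a, cK a = G.c (ι a)) :
    ∃ e : K ⊕ (rest G ι).V ≃ G.V, IsIso (Glue gK cK (rest G ι)) G e ∧
      ∀ k, e (Sum.inl k) = ι k := by
  refine ⟨_, iso_of_bij (A := Glue gK cK (rest G ι)) (B := G) (Sum.elim ι Subtype.val)
    ⟨?_, ?_⟩ ?_ ?_, fun k => rfl⟩
  · rintro (a | ⟨v, hv⟩) (b | ⟨w, hw⟩) h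
    · exact congrArg Sum.inl (hι h)
    · exact absurd ⟨a, h⟩ hw
    · exact absurd ⟨b, h.symm⟩ hv
    · exact congrArg Sum.inr (Subtype.ext h)
  · intro v
    by_cases hv : v ∈ Set.range ι
    · obtain ⟨k, rfl⟩ := hv
      exact ⟨Sum.inl k, rfl⟩
    · exact ⟨Sum.inr ⟨v, hv⟩, rfl⟩
  · rintro (a | ⟨v, hv⟩) (b | ⟨w, hw⟩)
    · exact hg a b
    · exact Iff.rfl
    · exact G.g.adj_comm _ _
    · exact Iff.rfl
  · rintro (a | ⟨v, hv⟩)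
    · exact hc a
    · rfl

lemma rest_le {G H : CG L} {ι : K → G.V} {ι' : K → H.V} {f : G.V → H.V} (hf : IsEmb G H f)
    (h : ∀ k, f (ι k) = ι' k) : Le (rest G ι) (rest H ι') := by
  refine ⟨fun v => ⟨f v.1, ?_⟩, ⟨fun v w h => ?_, fun v w h => ?_, ?_⟩⟩
  · rintro ⟨k, hk⟩
    rw [← h] at hk
    exact v.2 ⟨k, hf.inj hk⟩
  · exact Subtype.ext (hf.inj (congrArg Subtype.val h))
  · exact hf.adj _ _ h
  · rintro v (l | k) hx
    · exact hf.col _ hx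
    · have := hf.adj _ _ hx
      rw [h] at this
      exact this

lemma fix_back {G H : CG L} {X : Set G.V} (hX : X.Finite) {Y : Set H.V} {φ : G.V → H.V}
    {ψ : H.V → G.V} (hφ : IsEmb G H φ) (hψ : IsEmb H G ψ) (h1 : φ '' X = Y) (h2 : ψ '' Y = X) :
    ∃ ψ', IsEmb H G ψ' ∧ ∀ x ∈ X, ψ' (φ x) = x := by
  have hχ := hψ.comp hφ
  have hmap : ∀ x : X, ψ (φ x) ∈ X := by
    rintro ⟨x, hx⟩
    have h3 : ψ (φ x) ∈ ψ '' Y := ⟨_, by rw [← h1]; exact ⟨x, hx, rfl⟩, rfl⟩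
    rw [h2] at h3
    exact h3
  haveI : Finite X := hX
  let σ : X → X := fun x => ⟨ψ (φ x), hmap x⟩
  have hσ : Function.Bijective σ := by
    rw [← Finite.injective_iff_bijective]
    intro x y h
    exact Subtype.ext (hχ.inj (congrArg Subtype.val h))
  let p : Equiv.Perm X := Equiv.ofBijective σ hσ
  have hit : ∀ n, IsEmb G G ((fun x => ψ (φ x))^[n]) := by
    intro n
    induction n with
    | zero => exact IsEmb.id G
    | succ n ih => exact ih.comp hχ
  have hpow : ∀ n, ∀ x : X, ((fun x => ψ (φ x))^[n] x.1) = ((p ^ n) x).1 := by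
    intro n
    induction n with
    | zero => exact fun x => rfl
    | succ n ih =>
      intro x
      rw [Function.iterate_succ_apply, pow_succ, Equiv.Perm.mul_apply]
      exact ih (p x)
  have hpos : 0 < orderOf p := orderOf_pos p
  refine ⟨_, (hit (orderOf p - 1)).comp hψ, fun x hx => ?_⟩
  have h3 := hpow (orderOf p) ⟨x, hx⟩
  rw [pow_orderOf_eq_one] at h3
  rw [← Nat.sub_add_cancel hpos, Function.iterate_succ_apply] at h3
  exact h3

theorem reduce {G H : CG L} {X : Set G.V} (hX : X.Finite) {Y : Set H.V} {φ : G.V → H.V}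
    {ψ : H.V → G.V} (hφ : IsEmb G H φ) (hψ : IsEmb H G ψ) (h1 : φ '' X = Y) (h2 : ψ '' Y = X)
    (hn : ¬ ∃ e, IsIso G H e ∧ e '' X = Y) :
    ∃ (gK : SimpleGraph X) (cK : X → Set L) (FG FH : CG (L ⊕ X)) (eG : X ⊕ FG.V ≃ G.V)
      (eH : X ⊕ FH.V ≃ H.V), IsIso (Glue gK cK FG) G eG ∧ IsIso (Glue gK cK FH) H eH ∧
      (∀ k, eG (Sum.inl k) = k.1) ∧ (∀ k, eH (Sum.inl k) = φ k.1) ∧ Eqv FG FH ∧ ¬ Iso FG FH := by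
  obtain ⟨ψ', hψ', hfix⟩ := fix_back hX hφ hψ h1 h2
  let gK : SimpleGraph X := G.g.comap Subtype.val
  let cK : X → Set L := fun x => G.c x.1
  obtain ⟨eG, heG, hG⟩ := decomp (gK := gK) (cK := cK) G (ι := fun x : X => x.1)
    Subtype.val_injective (fun a b => Iff.rfl) (fun a => rfl)
  obtain ⟨eH, heH, hH⟩ := decomp (gK := gK) (cK := cK) H (ι := fun x : X => φ x.1)
    (hφ.inj.comp Subtype.val_injective) (fun a b => ⟨hφ.adj _ _, fun h => by
      have := hψ'.adj _ _ h
      rwa [hfix _ a.2, hfix _ b.2] at this⟩)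
    (fun a => (hφ.col _).antisymm (by
      have := hψ'.col (φ a.1)
      rwa [hfix _ a.2] at this))
  refine ⟨gK, cK, _, _, eG, eH, heG, heH, hG, hH, ⟨rest_le hφ fun k => rfl,
    rest_le hψ' fun k => hfix _ k.2⟩, ?_⟩
  rintro ⟨e, he⟩
  refine hn ⟨_, heG.symm.trans ((glue_iso he).trans heH), ?_⟩
  have key : ∀ x ∈ X, (eG.symm.trans ((Equiv.sumCongr (Equiv.refl _) e).trans eH)) x = φ x := by
    intro x hx
    have h3 : eG.symm x = Sum.inl ⟨x, hx⟩ := by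
      rw [Equiv.symm_apply_eq, hG]
    simp [h3, hH]
  rw [← h1]
  exact Set.image_congr key

/-- Isomorphism of glued graphs permuting the vertices of the base. -/
def GIso (gK : SimpleGraph K) (cK : K → Set L) (F F' : CG (L ⊕ K)) : Prop :=
  ∃ e, IsIso (Glue gK cK F) (Glue gK cK F') e ∧ ∃ σ : Equiv.Perm K, ∀ k,
    e (Sum.inl k) = Sum.inl (σ k)

lemma gIso_of_image [Finite K] {e : K ⊕ F.V ≃ K ⊕ F'.V}
    (he : IsIso (Glue gK cK F) (Glue gK cK F') e)
    (h : e '' Set.range Sum.inl = Set.range Sum.inl) : GIso gK cK F F' := by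
  have h1 : ∀ k, ∃ k', e (Sum.inl k) = Sum.inl k' := by
    intro k
    have : e (Sum.inl k) ∈ Set.range Sum.inl := by
      rw [← h]
      exact ⟨_, ⟨k, rfl⟩, rfl⟩
    obtain ⟨k', hk'⟩ := this
    exact ⟨k', hk'.symm⟩
  choose σ hσ using h1
  have hb : Function.Bijective σ := by
    rw [← Finite.injective_iff_bijective]
    intro x y h
    exact Sum.inl_injective (e.injective (by rw [hσ, hσ, h]))
  exact ⟨e, he, Equiv.ofBijective σ hb, hσ⟩

theorem pigeon [Finite K] (gK : SimpleGraph K) (cK : K → Set L) (F : ℕ → CG (L ⊕ K))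
    (hF : ∀ n m, n ≠ m → ¬ Iso (F n) (F m)) :
    ∃ s : ℕ → ℕ, ∀ i j, i ≠ j → ¬ GIso gK cK (F (s i)) (F (s j)) := by
  let S : Setoid ℕ := ⟨fun i j => GIso gK cK (F i) (F j), by
    refine ⟨fun i => ⟨Equiv.refl _, ⟨IsEmb.id _, IsEmb.id _⟩, Equiv.refl _, fun k => rfl⟩, ?_, ?_⟩
    · rintro i j ⟨e, he, σ, hσ⟩
      refine ⟨e.symm, he.symm, σ.symm, fun k => ?_⟩
      rw [Equiv.symm_apply_eq, hσ]
      simp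
    · rintro i j k ⟨e, he, σ, hσ⟩ ⟨e', he', σ', hσ'⟩
      refine ⟨_, he.trans he', σ.trans σ', fun k => ?_⟩
      change e' (e (Sum.inl k)) = _
      rw [hσ, hσ']
      rfl⟩
  have hinf : Infinite (Quotient S) := by
    by_contra hfin
    rw [not_infinite_iff_finite] at hfin
    have hfib : ∀ q : Quotient S, Finite (Quotient.mk S ⁻¹' {q}) := by
      intro q
      induction q using Quotient.ind with
      | _ i =>
      have h1 : ∀ j : (Quotient.mk S ⁻¹' {Quotient.mk S i}), GIso gK cK (F i) (F j.1) :=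
        fun j => Quotient.exact (s := S) (Eq.symm j.2)
      choose e he σ hσ using h1
      refine Finite.of_injective σ ?_
      intro j j' hjj
      by_contra hne
      refine hF j.1 j'.1 (fun h => hne (Subtype.ext h)) ?_
      refine iso_of_glue ((he j).symm.trans (he j')) fun k => ?_
      change e j' ((e j).symm (Sum.inl k)) = _
      have : (e j).symm (Sum.inl k) = Sum.inl ((σ j).symm k) := by
        rw [Equiv.symm_apply_eq, hσ]
        simp
      rw [this, hσ, hjj]
      simp
    have h3 : (Set.univ : Set ℕ).Finite := by
      have := Set.Finite.preimage' (f := Quotient.mk S) (Set.toFinite (Set.univ : Set (Quotient S)))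
        (fun q _ => Set.toFinite _)
      simpa using this
    exact Set.infinite_univ h3
  let t := Infinite.natEmbedding (Quotient S)
  refine ⟨fun i => (t i).out, fun i j hij h => hij (t.injective ?_)⟩
  rw [← Quotient.out_eq (t i), ← Quotient.out_eq (t j)]
  exact Quotient.sound h

lemma attach [Nonempty K] {J : Type u} {D : J → CG (L ⊕ K)} (h : Conn (Glue gK cK F))
    (hi : Iso F (Sg J D)) (hD : ∀ j, Conn (D j)) (j : J) : ∃ v k, Sum.inr k ∈ (D j).c v := by
  have h' := conn_of_iso (hi.glue (gK := gK) (cK := cK)) h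
  by_contra hcon
  push Not at hcon
  obtain ⟨⟨v⟩, -⟩ := hD j
  obtain ⟨k0⟩ := ‹Nonempty K›
  have key : ∀ x, ReflTransGen (Glue gK cK (Sg J D)).g.Adj (Sum.inr ⟨j, v⟩) x →
      ∃ w, x = Sum.inr ⟨j, w⟩ := by
    intro x hx
    induction hx with
    | refl => exact ⟨v, rfl⟩
    | @tail b c _ hbc ih =>
      obtain ⟨w, rfl⟩ := ih
      rcases c with k | ⟨j', w'⟩
      · exact absurd hbc (hcon w k)
      · have : j = j' := Sg_idx (C := D) hbc
        subst this
        exact ⟨w', rfl⟩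
  obtain ⟨w, hw⟩ := key _ (h'.2 _ (Sum.inl k0))
  exact absurd hw (by simp)

lemma rtg_symm {V : Type u} {G : SimpleGraph V} {x y : V} (h : ReflTransGen G.Adj x y) :
    ReflTransGen G.Adj y x :=
  (SimpleGraph.reachable_iff_reflTransGen y x).1
    ((SimpleGraph.reachable_iff_reflTransGen x y).2 h).symm

lemma conn_glue [Nonempty K] {J : Type u} {D : J → CG (L ⊕ K)} (h : Conn (Glue gK cK F))
    (hle : Le F (Sg J D)) (hD : ∀ j, Conn (D j)) (hat : ∀ j, ∃ v k, Sum.inr k ∈ (D j).c v) :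
    Conn (Glue gK cK (Sg J D)) := by
  obtain ⟨f, hf⟩ := hle
  obtain ⟨k0⟩ := ‹Nonempty K›
  have key : ∀ x, ReflTransGen (Glue gK cK (Sg J D)).g.Adj x (Sum.inl k0) := by
    have h1 : ∀ k, ReflTransGen (Glue gK cK (Sg J D)).g.Adj (Sum.inl k) (Sum.inl k0) := by
      intro k
      exact rtg_lift _ (glue_emb (gK := gK) (cK := cK) hf).adj (h.2 (Sum.inl k) (Sum.inl k0))
    rintro (k | ⟨j, w⟩)
    · exact h1 k
    · obtain ⟨v, k, hk⟩ := hat j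
      have h2 : ReflTransGen (Glue gK cK (Sg J D)).g.Adj (Sum.inr ⟨j, w⟩) (Sum.inr ⟨j, v⟩) :=
        rtg_lift (s := (Glue gK cK (Sg J D)).g.Adj) (fun x : (D j).V => Sum.inr ⟨j, x⟩)
          (fun a b hab => (Sg_adj (C := D) j a b).2 hab) ((hD j).2 w v)
      have h3 : (Glue gK cK (Sg J D)).g.Adj (Sum.inr ⟨j, v⟩) (Sum.inl k) := hk
      exact (h2.tail h3).trans (h1 k)
  exact ⟨⟨Sum.inl k0⟩, fun x y => (key x).trans (rtg_symm (key y))⟩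

end glue

lemma rayless_of_inj {V W : Type u} {G : SimpleGraph V} {H : SimpleGraph W} {f : V → W}
    (hi : Function.Injective f) (hf : ∀ x y, G.Adj x y → H.Adj (f x) (f y))
    (hH : H.IsRayless) : G.IsRayless := by
  rintro ⟨s, hs, ha⟩
  exact hH ⟨fun n => f (s n), hi.comp hs, fun n => hf _ _ (ha n)⟩

lemma rk_piece {L : Type u} {P : CG L} (hP : Conn P) {W : Type u} {H : SimpleGraph W}
    {f : P.V → W} (hi : Function.Injective f) (hf : ∀ x y, P.g.Adj x y → H.Adj (f x) (f y))
    {α : Ordinal.{u}} {K : Set W} (hS : Sep H α K) (hK : ∀ x, f x ∉ K) :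
    ∃ β < α, Rk P.g β Set.univ := by
  have h1 : COn P.g Set.univ := by
    have := COn_range hP (IsEmb.id P)
    simpa using this
  obtain ⟨β, hβ, hr⟩ := hS.2 (f '' Set.univ) (by rintro _ ⟨x, -, rfl⟩; exact hK x)
    (COn_image hf h1)
  exact ⟨β, hβ, Rk_pull hi hf β _ _ subset_rfl hr⟩

end Tw

namespace Tw
open Relation

section
variable {L K : Type u} {gK : SimpleGraph K} {cK : K → Set L} {F F' : CG (L ⊕ K)} {G : CG L}

lemma emb_glue {e : K ⊕ F.V ≃ G.V} (he : IsIso (Glue gK cK F) G e) (h : Le F F') :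
    ∃ f, IsEmb G (Glue gK cK F') f ∧ ∀ k, f (e (Sum.inl k)) = Sum.inl k := by
  obtain ⟨f, hf⟩ := h
  refine ⟨_, (glue_emb hf).comp he.2, fun k => ?_⟩
  simp

lemma glue_emb_to {e : K ⊕ F.V ≃ G.V} (he : IsIso (Glue gK cK F) G e) (h : Le F' F) :
    ∃ f, IsEmb (Glue gK cK F') G f ∧ ∀ k, f (Sum.inl k) = e (Sum.inl k) := by
  obtain ⟨f, hf⟩ := h
  exact ⟨_, he.1.comp (glue_emb hf), fun k => rfl⟩

/-- Pieces outside the base have smaller rank and are rayless. -/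
lemma pieces {e : K ⊕ F.V ≃ G.V} (he : IsIso (Glue gK cK F) G e) {α : Ordinal.{u}} {X : Set G.V}
    (hS : Sep G.g α X) (hX : ∀ x ∈ X, ∃ k, e (Sum.inl k) = x) (hr : G.g.IsRayless)
    {I : Type u} {C : I → CG (L ⊕ K)} (hC : ∀ i, Conn (C i)) (hi : Iso F (Sg I C)) (i : I) :
    (C i).g.IsRayless ∧ ∃ β < α, Rk (C i).g β Set.univ := by
  obtain ⟨f, hf⟩ := hi.eqv.2
  have hf' := hf.comp (IsEmb_incl i)
  have h1 : Function.Injective (fun x : (C i).V => e (Sum.inr (f ⟨i, x⟩))) :=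
    fun x y h => hf'.inj (Sum.inr_injective (e.injective h))
  have h2 : ∀ x y : (C i).V, (C i).g.Adj x y →
      G.g.Adj (e (Sum.inr (f ⟨i, x⟩))) (e (Sum.inr (f ⟨i, y⟩))) :=
    fun x y h => he.1.adj (Sum.inr _) (Sum.inr _) (hf'.adj x y h)
  refine ⟨rayless_of_inj h1 h2 hr, rk_piece (hC i) h1 h2 hS fun x hx => ?_⟩
  obtain ⟨k, hk⟩ := hX _ hx
  exact absurd (e.injective hk) (by simp)

end

theorem thmM (α : Ordinal.{u}) : ∀ (L : Type u) (G H : CG L), Conn G → G.g.IsRayless →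
    Rk G.g α Set.univ → Conn H → Eqv G H → ¬ Iso G H → Many G Conn := by
  induction α using WellFoundedLT.induction with
  | ind α ih =>
  intro L G H hGc hGr hrk hHc heqv hniso
  by_cases hβ : ∃ β < α, Rk G.g β Set.univ
  · obtain ⟨β, hβ, hR⟩ := hβ
    exact ih β hβ L G H hGc hGr hR hHc heqv hniso
  have hS := Sep_Ker hrk
  have hne : Nonempty (Ker G.g α) := by
    by_contra hcon
    exact hβ (rk_piece hGc (f := fun x => x) (fun _ _ h => h) (fun _ _ h => h) hS
      fun x hx => hcon ⟨⟨x, hx⟩⟩)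
  have hfinK : Finite (Ker G.g α) := hS.1
  have hHr : H.g.IsRayless := rayless_of_le heqv.2 hGr
  obtain ⟨⟨φ, hφ⟩, ⟨ψ, hψ⟩⟩ := id heqv
  have hrkH : Rk H.g α Set.univ := Rk_pull hψ.inj hψ.adj α _ _ (Set.subset_univ _) hrk
  have hSH := Sep_Ker hrkH
  have hk1 : φ '' Ker G.g α = Ker H.g α := Ker_eq hφ.inj hφ.adj hψ.inj hψ.adj α hrk
  have hk2 : ψ '' Ker H.g α = Ker G.g α := Ker_eq hψ.inj hψ.adj hφ.inj hφ.adj α hrkH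
  obtain ⟨gK, cK, FG, FH, eG, eH, heG, heH, hG, hH, hFeqv, hFn⟩ :=
    reduce hS.1 hφ hψ hk1 hk2 (fun ⟨e, he, _⟩ => hniso ⟨e, he⟩)
  obtain ⟨I, C, hC, hCi⟩ := exists_Sg FG
  obtain ⟨J, D, hD, hDi⟩ := exists_Sg FH
  have pC := pieces heG hS (fun x hx => ⟨⟨x, hx⟩, hG _⟩) hGr hC hCi
  have pD := pieces heH hSH (fun x hx => by
    rw [← hk1] at hx
    obtain ⟨y, hy, rfl⟩ := hx
    exact ⟨⟨y, hy⟩, hH _⟩) hHr hD hDi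
  have hM : Many (Sg I C) (Good (Set.range C ∪ Set.range D)) := by
    refine many_union hC hD (fun i => (pC i).1) (fun j => (pD j).1) ?_ ?_
      (hCi.eqv.symm.trans (hFeqv.trans hDi.eqv))
      (fun h => hFn (hCi.trans (h.trans hDi.symm)))
    · intro i A hA hAe hAn
      obtain ⟨β, hβ, hR⟩ := (pC i).2
      exact ih β hβ _ _ _ (hC i) (pC i).1 hR hA hAe.symm (fun h => hAn h.symm)
    · intro i A hA hAe hAn
      obtain ⟨β, hβ, hR⟩ := (pD i).2
      exact ih β hβ _ _ _ (hD i) (pD i).1 hR hA hAe.symm (fun h => hAn h.symm)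
  obtain ⟨F, hgood, hFe, hFni⟩ := hM
  have hFe' : ∀ n, Eqv FG (F n) := fun n => hCi.eqv.trans (hFe n)
  obtain ⟨s, hs⟩ := pigeon gK cK F hFni
  have cG : Conn (Glue gK cK FG) := conn_of_iso ⟨_, heG.symm⟩ hGc
  have cH : Conn (Glue gK cK FH) := conn_of_iso ⟨_, heH.symm⟩ hHc
  have hker : ∀ n, Rk (Glue gK cK (F n)).g α Set.univ ∧
      Ker (Glue gK cK (F n)).g α = Set.range Sum.inl := by
    intro n
    obtain ⟨f, hf, hfk⟩ := emb_glue heG (hFe' n).1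
    obtain ⟨f', hf', -⟩ := glue_emb_to heG (hFe' n).2
    refine ⟨Rk_pull hf'.inj hf'.adj α _ _ (Set.subset_univ _) hrk, ?_⟩
    rw [← Ker_eq hf.inj hf.adj hf'.inj hf'.adj α hrk]
    ext x
    constructor
    · rintro ⟨y, hy, rfl⟩
      refine ⟨⟨y, hy⟩, ?_⟩
      rw [← hfk, hG]
    · rintro ⟨k, rfl⟩
      exact ⟨k.1, k.2, by rw [← hG k, hfk]⟩
  refine ⟨fun n => Glue gK cK (F (s n)), fun n => ?_, fun n => ?_, ?_⟩
  · obtain ⟨I', C', hF, hC'⟩ := hgood (s n)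
    have hle := (hFe' (s n)).1
    change Conn (Glue gK cK (F (s n)))
    rw [hF] at hle ⊢
    refine conn_glue cG hle (fun i => (hC' i).1) fun i => ?_
    obtain ⟨b, hb, f, hf⟩ := (hC' i).2
    have : ∃ v k, Sum.inr k ∈ b.c v := by
      rcases hb with ⟨i, rfl⟩ | ⟨j, rfl⟩
      · exact attach cG hCi hC i
      · exact attach cH hDi hD j
    obtain ⟨v, k, hk⟩ := this
    exact ⟨f v, k, hf.col v hk⟩
  · obtain ⟨f, hf, -⟩ := emb_glue heG (hFe' (s n)).1
    obtain ⟨f', hf', -⟩ := glue_emb_to heG (hFe' (s n)).2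
    exact ⟨⟨f, hf⟩, ⟨f', hf'⟩⟩
  · rintro n m hnm ⟨e, he⟩
    refine hs n m hnm (gIso_of_image he ?_)
    have := Ker_eq he.1.inj he.1.adj he.2.inj he.2.adj α (hker (s n)).1
    rw [(hker (s n)).2, (hker (s m)).2] at this
    exact this

lemma conn_rest {L K V : Type u} {G : SimpleGraph V} {X : Set V} {F : CG L} (E : K ⊕ F.V ≃ V)
    (hX : ∀ k, E (Sum.inl k) ∈ X) (hX' : ∀ v, E (Sum.inr v) ∉ X)
    (hadj : ∀ v w, G.Adj (E (Sum.inr v)) (E (Sum.inr w)) → F.g.Adj v w)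
    (h : (G.induce Xᶜ).Connected) : Conn F := by
  have h1 : ∀ x : (Xᶜ : Set V), ∃ v, E (Sum.inr v) = x.1 := by
    rintro ⟨x, hx⟩
    obtain ⟨k | v, hv⟩ := E.surjective x
    · exact absurd (hv ▸ hX k) hx
    · exact ⟨v, hv⟩
  choose f hf using h1
  have hff : ∀ v, f ⟨E (Sum.inr v), hX' v⟩ = v := fun v =>
    Sum.inr_injective (E.injective (hf _))
  obtain ⟨x0⟩ := h.nonempty
  refine ⟨⟨f x0⟩, fun v w => ?_⟩
  have h2 := (SimpleGraph.reachable_iff_reflTransGen _ _).1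
    (h.preconnected ⟨E (Sum.inr v), hX' v⟩ ⟨E (Sum.inr w), hX' w⟩)
  have h3 := rtg_lift (s := F.g.Adj) f (fun a b hab => hadj _ _ (by rw [hf, hf]; exact hab)) h2
  rwa [hff, hff] at h3

lemma conn_glue_compl {L K : Type u} {gK : SimpleGraph K} {cK : K → Set L} {F : CG (L ⊕ K)}
    (h : Conn F) : ((Glue gK cK F).g.induce (Set.range Sum.inl)ᶜ).Connected := by
  have hm : ∀ v : F.V, (Sum.inr v : K ⊕ F.V) ∈ (Set.range Sum.inl)ᶜ := by
    rintro v ⟨k, hk⟩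
    exact absurd hk (by simp)
  obtain ⟨⟨v0⟩, hc⟩ := h
  refine (SimpleGraph.connected_iff _).2 ⟨?_, ⟨⟨Sum.inr v0, hm v0⟩⟩⟩
  rintro ⟨k | v, hv⟩ ⟨k' | w, hw⟩
  · exact absurd ⟨k, rfl⟩ hv
  · exact absurd ⟨k, rfl⟩ hv
  · exact absurd ⟨k', rfl⟩ hw
  · rw [SimpleGraph.reachable_iff_reflTransGen]
    exact rtg_lift (s := ((Glue gK cK F).g.induce (Set.range Sum.inl)ᶜ).Adj)
      (fun v => ⟨Sum.inr v, hm v⟩) (fun a b hab => hab) (hc v w)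

lemma pairIso_cancel {V W W' : Type u} {G : SimpleGraph V} {X : Set V} {A : SimpleGraph W}
    {Y : Set W} {B : SimpleGraph W'} {Z : Set W'} (h : PairIso G X A Y) (h' : PairIso G X B Z) :
    PairIso A Y B Z := by
  obtain ⟨γ, rfl⟩ := h
  obtain ⟨δ, rfl⟩ := h'
  refine ⟨γ.symm.trans δ, ?_⟩
  ext z
  simp

end Tw

open Tw

/-- If the pairs `(G, X)` and `(H, Y)` (with `G`, `H` rayless, `X`, `Y` finite, and
`G − X`, `H − Y` connected) are weak twins, then `(G, X)` has infinitely many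
pairwise non-isomorphic connected weak twins. -/
theorem connected_weakTwinPairs_infinite {V W : Type u}
    (G : SimpleGraph V) (H : SimpleGraph W)
    (X : Set V) (Y : Set W) (hX : X.Finite) (hY : Y.Finite)
    (hG : G.IsRayless) (hH : H.IsRayless)
    (hGc : (G.induce Xᶜ).Connected) (hHc : (H.induce Yᶜ).Connected)
    (htwin : WeakTwinPairs G X H Y) :
    ∃ F : ℕ → Σ W' : Type u, SimpleGraph W' × Set W',
      (∀ i, (F i).2.2.Finite) ∧
      (∀ i, ((F i).2.1.induce ((F i).2.2)ᶜ).Connected) ∧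
      (∀ i j, i ≠ j → ¬ PairIso (F i).2.1 (F i).2.2 (F j).2.1 (F j).2.2) ∧
      ∀ i, WeakTwinPairs G X (F i).2.1 (F i).2.2 := by
  obtain ⟨hn, ⟨φ, hφ, hφX⟩, ⟨ψ, hψ, hψY⟩⟩ := htwin
  let GG : CG PEmpty.{u+1} := ⟨V, G, fun _ => ∅⟩
  let HH : CG PEmpty.{u+1} := ⟨W, H, fun _ => ∅⟩
  have e1 : IsEmb GG HH φ := ⟨hφ, fun _ _ h => φ.map_adj h, fun _ => subset_rfl⟩
  have e2 : IsEmb HH GG ψ := ⟨hψ, fun _ _ h => ψ.map_adj h, fun _ => subset_rfl⟩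
  obtain ⟨gK, cK, FG, FH, eG, eH, heG, heH, hG1, hH1, hFeqv, hFn⟩ :=
    reduce (G := GG) (H := HH) hX e1 e2 hφX hψY (by
      rintro ⟨e, he, heX⟩
      exact hn ⟨⟨e, fun {a b} => (he.adj a b).symm⟩, heX⟩)
  have hfinK : Finite X := hX
  have cG : Conn FG := by
    refine conn_rest (G := G) (X := X) eG (fun k => ?_) (fun v hv => ?_) (fun v w h => ?_) hGc
    · rw [hG1]; exact k.2
    · have := hG1 ⟨_, hv⟩
      exact absurd (eG.injective this) (by simp)
    · exact (heG.adj (Sum.inr v) (Sum.inr w)).2 h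
  have cH : Conn FH := by
    refine conn_rest (G := H) (X := Y) eH (fun k => ?_) (fun v hv => ?_) (fun v w h => ?_) hHc
    · rw [hH1, ← hφX]; exact ⟨_, k.2, rfl⟩
    · rw [← hφX] at hv
      obtain ⟨x, hx, hxv⟩ := hv
      have := (hH1 ⟨x, hx⟩).trans hxv
      exact absurd (eH.injective this) (by simp)
    · exact (heH.adj (Sum.inr v) (Sum.inr w)).2 h
  have hr : FG.g.IsRayless := rayless_of_inj (H := G) (f := fun v => eG (Sum.inr v))
    (fun v w h => Sum.inr_injective (eG.injective h))
    (fun v w h => heG.1.adj (Sum.inr v) (Sum.inr w) h) hG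
  obtain ⟨α, hα⟩ := exists_Rk hr
  obtain ⟨F, hFc, hFe, hFni⟩ := thmM α _ FG FH cG hr hα cH hFeqv hFn
  obtain ⟨s, hs⟩ := pigeon gK cK F hFni
  let P : ℕ → Σ W' : Type u, SimpleGraph W' × Set W' := fun n =>
    ⟨X ⊕ (F (s n)).V, (Glue gK cK (F (s n))).g, Set.range Sum.inl⟩
  have hP1 : ∀ n, (P n).2.2.Finite := fun n => Set.finite_range _
  have hP2 : ∀ n, ((P n).2.1.induce ((P n).2.2)ᶜ).Connected := fun n =>
    conn_glue_compl (cK := cK) (hFc (s n))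
  have hP3 : ∀ i j, i ≠ j → ¬ PairIso (P i).2.1 (P i).2.2 (P j).2.1 (P j).2.2 := by
    rintro i j hij ⟨γ, hγ⟩
    refine hs i j hij (gIso_of_image (e := γ.toEquiv) ?_ hγ)
    have hcK : ∀ (A B : Set PEmpty.{u+1}), A ⊆ B := fun A B x => x.elim
    refine ⟨⟨γ.injective, fun x y h => γ.map_rel_iff.2 h, fun x => hcK _ _⟩,
      ⟨γ.symm.injective, fun x y h => γ.symm.map_rel_iff.2 h, fun x => hcK _ _⟩⟩
  have hP4 : ∀ n, (∃ f : G →g (P n).2.1, Function.Injective f ∧ ⇑f '' X = (P n).2.2) ∧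
      (∃ f : (P n).2.1 →g G, Function.Injective f ∧ ⇑f '' (P n).2.2 = X) := by
    intro n
    obtain ⟨f, hf, hfk⟩ := emb_glue heG (hFe (s n)).1
    obtain ⟨f', hf', hfk'⟩ := glue_emb_to heG (hFe (s n)).2
    refine ⟨⟨⟨f, fun {a b} h => hf.adj a b h⟩, hf.inj, ?_⟩,
      ⟨⟨f', fun {a b} h => hf'.adj a b h⟩, hf'.inj, ?_⟩⟩
    · ext x
      constructor
      · rintro ⟨y, hy, rfl⟩
        exact ⟨⟨y, hy⟩, by rw [← hfk, hG1]; rfl⟩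
      · rintro ⟨k, rfl⟩
        exact ⟨k.1, k.2, by rw [← hfk, hG1]; rfl⟩
    · ext x
      constructor
      · rintro ⟨_, ⟨k, rfl⟩, rfl⟩
        have h5 : f' (Sum.inl k) = k.1 := (hfk' k).trans (hG1 k)
        change f' (Sum.inl k) ∈ X
        rw [h5]
        exact k.2
      · intro hx
        exact ⟨_, ⟨⟨x, hx⟩, rfl⟩, (hfk' _).trans (hG1 _)⟩
  obtain ⟨N, hN⟩ : ∃ N, ∀ n, ¬ PairIso G X (P (N + n)).2.1 (P (N + n)).2.2 := by
    by_cases h : ∃ n, PairIso G X (P n).2.1 (P n).2.2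
    · obtain ⟨n0, h0⟩ := h
      refine ⟨n0 + 1, fun n hn => hP3 n0 (n0 + 1 + n) (by omega) (pairIso_cancel h0 hn)⟩
    · push Not at h
      exact ⟨0, fun n => h _⟩
  exact ⟨fun n => P (N + n), fun n => hP1 _, fun n => hP2 _,
    fun i j hij => hP3 _ _ (by omega), fun n => ⟨hN n, hP4 _⟩⟩
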